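/- arXiv:1009.2717 — 4 statements merged into one kernel-verified Lean document; each statement's English description precedes it below -/
import Mathlib

section
/- For every positive integer N and every bilinear form U : ℓ_∞^N × ℓ_∞^N → ℝ, (Σ_{i,j=1}^N |U(e_i, e_j)|^{4/3})^{3/4} ≤ √2 · ‖U‖. -/
namespace LW

open Finset

variable {ι : Type*} [Fintype ι] [DecidableEq ι]

/-- Walsh functions on the cube. -/
noncomputable def w (S : Finset ι) (T : ι → ℤˣ) : ℝ := ∏ i ∈ S, (((T i : ℤˣ) : ℤ) : ℝ)

noncomputable def hat (f : (ι → ℤˣ) → ℝ) (S : Finset ι) : ℝ := ∑ T, f T * w S T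

noncomputable def flip (i : ι) : ι → ℤˣ := fun j => if j = i then -1 else 1

lemma w_mul (S : Finset ι) (T T' : ι → ℤˣ) : w S (T * T') = w S T * w S T' := by
  simp [w, Finset.prod_mul_distrib]

lemma w_complete (T T' : ι → ℤˣ) :
    ∑ S : Finset ι, w S T * w S T' = if T = T' then (2 : ℝ) ^ Fintype.card ι else 0 := by
  simp_rw [← w_mul]
  have h : ∑ S : Finset ι, w S (T * T') = ∏ i, (1 + ((((T * T') i : ℤˣ) : ℤ) : ℝ)) := by
    rw [Finset.prod_one_add, Finset.powerset_univ]; rfl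
  rw [h]
  split_ifs with hT
  · subst hT
    have : ∀ i, (1 + ((((T * T) i : ℤˣ) : ℤ) : ℝ)) = 2 := by
      intro i
      rcases Int.units_eq_one_or (T i) with h | h <;> simp [h] <;> norm_num
    simp only [this]
    simp
  · obtain ⟨i, hi⟩ := Function.ne_iff.mp hT
    apply Finset.prod_eq_zero (Finset.mem_univ i)
    rcases Int.units_eq_one_or (T i) with h | h <;>
      rcases Int.units_eq_one_or (T' i) with h' | h' <;> simp_all

lemma parseval (f g : (ι → ℤˣ) → ℝ) :
    ∑ S, hat f S * hat g S = 2 ^ Fintype.card ι * ∑ T, f T * g T := by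
  calc ∑ S, hat f S * hat g S
      = ∑ S, ∑ T, ∑ T', f T * g T' * (w S T * w S T') := by
        refine Finset.sum_congr rfl fun S _ => ?_
        rw [hat, hat, Finset.sum_mul_sum]
        refine Finset.sum_congr rfl fun T _ => Finset.sum_congr rfl fun T' _ => by ring
    _ = ∑ T, ∑ T', f T * g T' * ∑ S, (w S T * w S T') := by
        rw [Finset.sum_comm]
        refine Finset.sum_congr rfl fun T _ => ?_
        rw [Finset.sum_comm]
        refine Finset.sum_congr rfl fun T' _ => ?_
        rw [Finset.mul_sum]
    _ = _ := by
        simp_rw [w_complete]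
        rw [Finset.mul_sum]
        refine Finset.sum_congr rfl fun T _ => ?_
        simp; ring

lemma hat_translate (f : (ι → ℤˣ) → ℝ) (u : ι → ℤˣ) (S : Finset ι) :
    hat (fun T => f (T * u)) S = w S u * hat f S := by
  unfold hat
  rw [Finset.mul_sum]
  refine Fintype.sum_equiv (Equiv.mulRight u) _ _ fun T => ?_
  have h : w S u * w S u = 1 := by
    rw [← w_mul]
    have : u * u = 1 := by ext i; simp
    rw [this]; simp [w]
  simp only [Equiv.coe_mulRight, w_mul]
  linear_combination (-f (T * u) * w S T) * h

lemma w_flip (S : Finset ι) (i : ι) : w S (flip i) = if i ∈ S then -1 else 1 := by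
  unfold w flip
  have : ∀ j, ((((if j = i then -1 else 1 : ℤˣ)) : ℤ) : ℝ) = if j = i then -1 else 1 := by
    intro j; split_ifs <;> simp
  simp_rw [this]
  rw [Finset.prod_ite_eq']

lemma sum_w_flip (S : Finset ι) : ∑ i, w S (flip i) = (Fintype.card ι : ℝ) - 2 * S.card := by
  simp_rw [w_flip]
  have : ∀ i, (if i ∈ S then (-1 : ℝ) else 1) = 1 - 2 * (if i ∈ S then 1 else 0) := by
    intro i; split_ifs <;> norm_num
  simp_rw [this, Finset.sum_sub_distrib, ← Finset.mul_sum]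
  simp

noncomputable def lin (a : ι → ℝ) (T : ι → ℤˣ) : ℝ := ∑ i, a i * (((T i : ℤˣ) : ℤ) : ℝ)

lemma lin_flip (a : ι → ℝ) (T : ι → ℤˣ) (i : ι) :
    lin a (T * flip i) = lin a T - 2 * (a i * (((T i : ℤˣ) : ℤ) : ℝ)) := by
  unfold lin flip
  have : ∀ j, a j * ((((T * fun j => if j = i then (-1 : ℤˣ) else 1) j : ℤˣ) : ℤ) : ℝ)
      = a j * (((T j : ℤˣ) : ℤ) : ℝ) - if j = i then 2 * (a j * (((T j : ℤˣ) : ℤ) : ℝ)) else 0 := by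
    intro j; by_cases h : j = i <;> simp [h]; ring
  simp_rw [this, Finset.sum_sub_distrib]
  simp

lemma sum_lin_sq (a : ι → ℝ) : ∑ T, lin a T ^ 2 = 2 ^ Fintype.card ι * ∑ i, a i ^ 2 := by
  have h1 : ∀ i j, ∑ T : ι → ℤˣ, (((T i : ℤˣ) : ℤ) : ℝ) * (((T j : ℤˣ) : ℤ) : ℝ)
      = if i = j then 2 ^ Fintype.card ι else 0 := by
    intro i j
    split_ifs with h
    · subst h
      have : ∀ T : ι → ℤˣ, (((T i : ℤˣ) : ℤ) : ℝ) * (((T i : ℤˣ) : ℤ) : ℝ) = 1 := by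
        intro T
        rcases Int.units_eq_one_or (T i) with h | h <;> simp [h]
      simp [this]
    · have : ∑ T : ι → ℤˣ, (((T i : ℤˣ) : ℤ) : ℝ) * (((T j : ℤˣ) : ℤ) : ℝ)
        = ∑ T : ι → ℤˣ, -((((T i : ℤˣ) : ℤ) : ℝ) * (((T j : ℤˣ) : ℤ) : ℝ)) := by
        refine Fintype.sum_equiv (Equiv.mulRight (flip i)) _ _ fun T => ?_
        simp [flip, Ne.symm h]
      rw [Finset.sum_neg_distrib] at this
      linarith
  calc ∑ T, lin a T ^ 2 = ∑ T : ι → ℤˣ, ∑ i, ∑ j, a i * a j * ((((T i : ℤˣ) : ℤ) : ℝ) * (((T j : ℤˣ) : ℤ) : ℝ)) := by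
        refine Finset.sum_congr rfl fun T _ => ?_
        rw [sq, lin, Finset.sum_mul_sum]
        refine Finset.sum_congr rfl fun i _ => Finset.sum_congr rfl fun j _ => by ring
    _ = ∑ i, ∑ j, a i * a j * ∑ T : ι → ℤˣ, ((((T i : ℤˣ) : ℤ) : ℝ) * (((T j : ℤˣ) : ℤ) : ℝ)) := by
        rw [Finset.sum_comm]
        refine Finset.sum_congr rfl fun T _ => ?_
        rw [Finset.sum_comm]
        refine Finset.sum_congr rfl fun T' _ => ?_
        rw [Finset.mul_sum]
    _ = _ := by
        simp_rw [h1]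
        rw [Finset.mul_sum]
        refine Finset.sum_congr rfl fun T _ => ?_
        simp; ring

/-- Khinchine with the sharp constant (Latala-Oleszkiewicz argument). -/
lemma khinchine_sq (a : ι → ℝ) :
    (2 : ℝ) ^ Fintype.card ι * ∑ T, lin a T ^ 2 ≤ 2 * (∑ T, |lin a T|) ^ 2 := by
  set f : (ι → ℤˣ) → ℝ := fun T => |lin a T| with hf
  set n : ℝ := (Fintype.card ι : ℝ) with hn
  have hpt : ∀ T, (n - 2) * f T ≤ ∑ i, f (T * flip i) := by
    intro T
    have h1 : ∑ i, lin a (T * flip i) = (n - 2) * lin a T := by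
      simp_rw [lin_flip, Finset.sum_sub_distrib, ← Finset.mul_sum]
      simp only [Finset.sum_const, Finset.card_univ, nsmul_eq_mul]
      change n * lin a T - 2 * lin a T = _
      ring
    calc (n - 2) * f T ≤ |n - 2| * f T :=
          mul_le_mul_of_nonneg_right (le_abs_self _) (abs_nonneg _)
      _ = |∑ i, lin a (T * flip i)| := by rw [h1, abs_mul]
      _ ≤ _ := Finset.abs_sum_le_sum_abs _ _
  have hP : ∑ S, hat f S ^ 2 = 2 ^ Fintype.card ι * ∑ T, lin a T ^ 2 := by
    have := parseval f f
    simp only [hf, abs_mul_abs_self] at this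
    simpa [sq] using this
  have hQ : ∑ S : Finset ι, (n - 2 * S.card) * hat f S ^ 2
      = 2 ^ Fintype.card ι * ∑ T, f T * ∑ i, f (T * flip i) := by
    simp_rw [Finset.mul_sum (s := (Finset.univ : Finset ι))]
    rw [Finset.sum_comm, Finset.mul_sum]
    simp_rw [← parseval f (fun T => f (T * flip _)), hat_translate]
    rw [Finset.sum_comm]
    refine Finset.sum_congr rfl fun S _ => ?_
    rw [← sum_w_flip, Finset.sum_mul]
    refine Finset.sum_congr rfl fun i _ => by ring
  have hR : (n - 2) * ∑ S, hat f S ^ 2 ≤ ∑ S : Finset ι, (n - 2 * S.card) * hat f S ^ 2 := by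
    rw [hP, hQ, mul_left_comm]
    refine mul_le_mul_of_nonneg_left ?_ (by positivity)
    rw [Finset.mul_sum]
    refine Finset.sum_le_sum fun T _ => ?_
    have := mul_le_mul_of_nonneg_left (hpt T) (abs_nonneg (lin a T))
    calc (n - 2) * lin a T ^ 2 = |lin a T| * ((n - 2) * f T) := by
          rw [← sq_abs]; simp only [hf]; ring
      _ ≤ _ := this
  have hodd : ∀ S : Finset ι, S.card = 1 → hat f S = 0 := by
    intro S hS
    have h1 := hat_translate f (-1) S
    have h2 : (fun T => f (T * -1)) = f := by
      funext T
      simp only [hf, lin]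
      simp
    obtain ⟨i, rfl⟩ := Finset.card_eq_one.mp hS
    rw [h2] at h1
    simp [w] at h1
    linarith
  have hterm : ∀ S : Finset ι, 2 * hat f S ^ 2 - (if S = ∅ then 4 * hat f S ^ 2 else 0)
      ≤ (2 * S.card - 2) * hat f S ^ 2 := by
    intro S
    split_ifs with h
    · subst h; simp; linarith
    · have h0 : 0 < S.card := Finset.card_pos.mpr (Finset.nonempty_iff_ne_empty.mpr h)
      rcases Nat.lt_or_ge 1 S.card with h1 | h1
      · have : (2 : ℝ) ≤ S.card := by exact_mod_cast h1
        nlinarith [sq_nonneg (hat f S)]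
      · rw [hodd S (by omega)]; simp
  have hs := Finset.sum_le_sum fun S (_ : S ∈ (Finset.univ : Finset (Finset ι))) => hterm S
  rw [Finset.sum_sub_distrib, ← Finset.mul_sum] at hs
  simp only [Finset.sum_ite_eq', Finset.mem_univ, if_true] at hs
  have he : hat f ∅ = ∑ T, |lin a T| := by simp [hat, w, hf]
  rw [← hP, ← he]
  have h3 : ∑ S : Finset ι, (2 * (S.card : ℝ) - 2) * hat f S ^ 2
      = (n - 2) * ∑ S, hat f S ^ 2 - ∑ S : Finset ι, (n - 2 * S.card) * hat f S ^ 2 := by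
    rw [Finset.mul_sum, ← Finset.sum_sub_distrib]
    refine Finset.sum_congr rfl fun S _ => by ring
  linarith

lemma khinchine (a : ι → ℝ) :
    (2 : ℝ) ^ Fintype.card ι * √(∑ i, a i ^ 2) ≤ √2 * ∑ T, |lin a T| := by
  have h := khinchine_sq a
  rw [sum_lin_sq] at h
  have h0 : 0 ≤ ∑ T, |lin a T| := Finset.sum_nonneg fun _ _ => abs_nonneg _
  have hs : 0 ≤ ∑ i, a i ^ 2 := Finset.sum_nonneg fun _ _ => sq_nonneg _
  refine abs_le_of_sq_le_sq' ?_ (by positivity) |>.2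
  rw [mul_pow, mul_pow, Real.sq_sqrt hs, Real.sq_sqrt (by norm_num)]
  linarith

lemma mixed {κ : Type*} [Fintype κ] (a : κ → ι → ℝ) (M : ℝ)
    (h : ∀ T : ι → ℤˣ, ∑ i, |lin (a i) T| ≤ M) :
    ∑ i, √(∑ j, a i j ^ 2) ≤ √2 * M := by
  have h2 : (0 : ℝ) < 2 ^ Fintype.card ι := by positivity
  refine le_of_mul_le_mul_left ?_ h2
  calc (2 : ℝ) ^ Fintype.card ι * ∑ i, √(∑ j, a i j ^ 2)
      ≤ ∑ i, √2 * ∑ T, |lin (a i) T| := by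
        rw [Finset.mul_sum]; exact Finset.sum_le_sum fun i _ => khinchine (a i)
    _ = √2 * ∑ T, ∑ i, |lin (a i) T| := by rw [← Finset.mul_sum, Finset.sum_comm]
    _ ≤ √2 * ∑ T : ι → ℤˣ, M := by
        gcongr with T; exact h T
    _ = _ := by simp; ring

lemma minkowski {κ : Type*} [Fintype κ] (a : κ → ι → ℝ) (B : ℝ)
    (hB : ∑ j, √(∑ i, a i j ^ 2) ≤ B) : ∑ i, (∑ j, |a i j|) ^ 2 ≤ B ^ 2 := by
  calc ∑ i, (∑ j, |a i j|) ^ 2 = ∑ i, ∑ j, ∑ k, |a i j| * |a i k| := by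
        simp_rw [sq, Finset.sum_mul_sum]
    _ = ∑ j, ∑ k, ∑ i, |a i j| * |a i k| := by
        rw [Finset.sum_comm]
        refine Finset.sum_congr rfl fun j _ => Finset.sum_comm
    _ ≤ ∑ j, ∑ k, √(∑ i, a i j ^ 2) * √(∑ i, a i k ^ 2) := by
        refine Finset.sum_le_sum fun j _ => Finset.sum_le_sum fun k _ => ?_
        have := Real.sum_mul_le_sqrt_mul_sqrt Finset.univ (fun i => |a i j|) (fun i => |a i k|)
        simpa using this
    _ = (∑ j, √(∑ i, a i j ^ 2)) ^ 2 := by rw [sq, Finset.sum_mul_sum]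
    _ ≤ B ^ 2 := by gcongr

lemma holder {κ : Type*} [Fintype κ] (f g : κ → ℝ) (hf : ∀ i, 0 ≤ f i) (hg : ∀ i, 0 ≤ g i) :
    ∑ i, f i ^ ((2 : ℝ) / 3) * g i ^ ((2 : ℝ) / 3)
      ≤ (∑ i, f i) ^ ((2 : ℝ) / 3) * (∑ i, g i ^ 2) ^ ((1 : ℝ) / 3) := by
  have hpq : (3 / 2 : ℝ).HolderConjugate 3 := by
    rw [Real.holderConjugate_iff]; norm_num
  have := Real.inner_le_Lp_mul_Lq_of_nonneg Finset.univ hpq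
    (f := fun i => f i ^ ((2 : ℝ) / 3)) (g := fun i => g i ^ ((2 : ℝ) / 3))
    (fun i _ => Real.rpow_nonneg (hf i) _) (fun i _ => Real.rpow_nonneg (hg i) _)
  have e1 : ∀ i, (f i ^ ((2 : ℝ) / 3)) ^ ((3 : ℝ) / 2) = f i := fun i => by
    rw [← Real.rpow_mul (hf i)]; norm_num
  have e2 : ∀ i, (g i ^ ((2 : ℝ) / 3)) ^ (3 : ℝ) = g i ^ 2 := fun i => by
    rw [← Real.rpow_mul (hg i), ← Real.rpow_natCast]; norm_num
  simp only [e1, e2] at this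
  convert this using 3
  norm_num

lemma blei {κ : Type*} [Fintype κ] (a : κ → ι → ℝ) (B : ℝ) (hB0 : 0 ≤ B)
    (hA : ∑ i, √(∑ j, a i j ^ 2) ≤ B) (hB : ∑ j, √(∑ i, a i j ^ 2) ≤ B) :
    (∑ i, ∑ j, |a i j| ^ ((4 : ℝ) / 3)) ^ ((3 : ℝ) / 4) ≤ B := by
  have h1 : ∑ i, ∑ j, |a i j| ^ ((4 : ℝ) / 3) ≤ B ^ ((4 : ℝ) / 3) := by
    calc ∑ i, ∑ j, |a i j| ^ ((4 : ℝ) / 3)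
        ≤ ∑ i, (√(∑ j, a i j ^ 2)) ^ ((2 : ℝ) / 3) * (∑ j, |a i j|) ^ ((2 : ℝ) / 3) := by
          refine Finset.sum_le_sum fun i _ => ?_
          have := holder (fun j => |a i j|) (fun j => |a i j|) (fun _ => abs_nonneg _)
            (fun _ => abs_nonneg _)
          have e : ∀ j, |a i j| ^ ((2 : ℝ) / 3) * |a i j| ^ ((2 : ℝ) / 3)
              = |a i j| ^ ((4 : ℝ) / 3) := fun j => by
            rw [← Real.rpow_add_of_nonneg (abs_nonneg _) (by norm_num) (by norm_num)]; norm_num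
          simp only [e, sq_abs] at this
          rw [mul_comm, Real.sqrt_eq_rpow, ← Real.rpow_mul
            (Finset.sum_nonneg fun _ _ => sq_nonneg _)]
          have e3 : (1 : ℝ) / 2 * (2 / 3) = 1 / 3 := by norm_num
          rw [e3]
          exact this
      _ ≤ (∑ i, √(∑ j, a i j ^ 2)) ^ ((2 : ℝ) / 3) * (∑ i, (∑ j, |a i j|) ^ 2) ^ ((1 : ℝ) / 3) :=
          holder _ _ (fun _ => Real.sqrt_nonneg _) (fun _ => Finset.sum_nonneg fun _ _ => abs_nonneg _)
      _ ≤ B ^ ((2 : ℝ) / 3) * (B ^ 2) ^ ((1 : ℝ) / 3) := by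
          have := minkowski a B hB
          gcongr
      _ = B ^ ((4 : ℝ) / 3) := by
          rw [← Real.rpow_natCast, ← Real.rpow_mul hB0,
            ← Real.rpow_add_of_nonneg hB0 (by norm_num) (by norm_num)]
          norm_num
  calc _ ≤ (B ^ ((4 : ℝ) / 3)) ^ ((3 : ℝ) / 4) := by
        refine Real.rpow_le_rpow ?_ h1 (by norm_num)
        exact Finset.sum_nonneg fun _ _ => Finset.sum_nonneg fun _ _ => Real.rpow_nonneg (abs_nonneg _) _
    _ = B := by rw [← Real.rpow_mul hB0]; norm_num

lemma row_bound {N : ℕ} (U : (Fin N → ℝ) →L[ℝ] (Fin N → ℝ) →L[ℝ] ℝ) (T : Fin N → ℤˣ) :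
    ∑ i, |lin (fun j => U (Pi.single i 1) (Pi.single j 1)) T| ≤ ‖U‖ := by
  set y : Fin N → ℝ := fun j => (((T j : ℤˣ) : ℤ) : ℝ) with hy
  have hlin : ∀ i, lin (fun j => U (Pi.single i 1) (Pi.single j 1)) T = U (Pi.single i 1) y := by
    intro i
    conv_rhs => rw [pi_eq_sum_univ' y, map_sum]
    unfold lin
    refine Finset.sum_congr rfl fun j _ => ?_
    rw [map_smul, smul_eq_mul, mul_comm]
  set x : Fin N → ℝ := fun i => SignType.sign (U (Pi.single i 1) y) with hx
  have hU : U x y = ∑ i, |U (Pi.single i 1) y| := by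
    conv_lhs => rw [pi_eq_sum_univ' x, map_sum, ContinuousLinearMap.sum_apply]
    refine Finset.sum_congr rfl fun i _ => ?_
    rw [map_smul, ContinuousLinearMap.smul_apply, smul_eq_mul]
    have : (fun j => if j = i then (1 : ℝ) else 0) = Pi.single i 1 := by
      ext k; simp [Pi.single_apply]
    rw [← sign_mul_self]
  simp_rw [hlin]
  rw [← hU]
  have hx1 : ‖x‖ ≤ 1 := by
    refine (pi_norm_le_iff_of_nonneg zero_le_one).2 fun i => ?_
    simp only [hx]
    rcases SignType.trichotomy (SignType.sign (U (Pi.single i 1) y)) with h | h | h <;> simp [h]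
  have hy1 : ‖y‖ ≤ 1 := by
    refine (pi_norm_le_iff_of_nonneg zero_le_one).2 fun i => ?_
    simp only [hy]
    rcases Int.units_eq_one_or (T i) with h | h <;> simp [h]
  calc U x y ≤ ‖U x y‖ := le_abs_self _
    _ ≤ ‖U‖ * ‖x‖ * ‖y‖ := U.le_opNorm₂ x y
    _ ≤ ‖U‖ * 1 * 1 := by gcongr
    _ = ‖U‖ := by ring

end LW

theorem stmt_11 (N : ℕ) (hN : 0 < N)
    (U : (Fin N → ℝ) →L[ℝ] (Fin N → ℝ) →L[ℝ] ℝ) :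
    (∑ i : Fin N, ∑ j : Fin N,
        |U (Pi.single i 1) (Pi.single j 1)| ^ ((4 : ℝ) / 3)) ^ ((3 : ℝ) / 4)
      ≤ Real.sqrt 2 * ‖U‖ := by
  refine LW.blei (fun i j => U (Pi.single i 1) (Pi.single j 1)) _ (by positivity) ?_ ?_
  · exact LW.mixed _ _ fun T => LW.row_bound U T
  · refine LW.mixed (fun j i => U (Pi.single i 1) (Pi.single j 1)) _ fun T => ?_
    have := LW.row_bound U.flip T
    rw [ContinuousLinearMap.opNorm_flip] at this
    simpa using this
end

section
/- For every positive integer m, every positive integer N, and every m-linear form U : ℓ_∞^N × ··· × ℓ_∞^N → ℝ, (Σ_{i_1,...,i_m=1}^N |U(e_{i_1},...,e_{i_m})|^{2m/(m+1)})^{(m+1)/(2m)} ≤ 2^{(m-1)/2} ‖U‖. -/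
lemma bh_kernel {ι : Type*} [Fintype ι] [DecidableEq ι] (e d : ι → ℤˣ) :
    ∑ S : Finset ι, (∏ i ∈ S, ((e i : ℤ) : ℝ)) * (∏ i ∈ S, ((d i : ℤ) : ℝ))
      = if e = d then (2:ℝ) ^ Fintype.card ι else 0 := by
  have h : ∀ S : Finset ι, (∏ i ∈ S, ((e i : ℤ) : ℝ)) * (∏ i ∈ S, ((d i : ℤ) : ℝ))
      = ∏ i ∈ S, (((e i : ℤ) : ℝ) * ((d i : ℤ) : ℝ)) := fun S => by rw [Finset.prod_mul_distrib]
  simp_rw [h]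
  rw [← Finset.powerset_univ, ← Finset.prod_one_add]
  split_ifs with hed
  · subst hed
    have : ∀ i, 1 + ((e i : ℤ) : ℝ) * ((e i : ℤ) : ℝ) = 2 := by
      intro i
      rcases Int.units_eq_one_or (e i) with h | h <;> rw [h] <;> norm_num
    simp [this]
  · obtain ⟨i, hi⟩ := Function.ne_iff.mp hed
    apply Finset.prod_eq_zero (Finset.mem_univ i)
    rcases Int.units_eq_one_or (e i) with h | h <;> rcases Int.units_eq_one_or (d i) with h' | h' <;>
      rw [h, h'] at hi ⊢ <;> simp at hi ⊢

lemma bh_parseval {ι : Type*} [Fintype ι] [DecidableEq ι] (f g : (ι → ℤˣ) → ℝ) :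
    ∑ S : Finset ι, (∑ e, f e * ∏ i ∈ S, ((e i : ℤ) : ℝ)) * (∑ e, g e * ∏ i ∈ S, ((e i : ℤ) : ℝ))
      = 2 ^ Fintype.card ι * ∑ e, f e * g e := by
  simp_rw [Finset.sum_mul_sum]
  rw [Finset.sum_comm]
  rw [Finset.mul_sum]
  refine Finset.sum_congr rfl fun e _ => ?_
  rw [Finset.sum_comm]
  have : ∀ d : ι → ℤˣ, ∑ S : Finset ι, (f e * ∏ i ∈ S, ((e i : ℤ) : ℝ)) * (g d * ∏ i ∈ S, ((d i : ℤ) : ℝ))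
     = f e * g d * if e = d then (2:ℝ) ^ Fintype.card ι else 0 := by
    intro d
    rw [← bh_kernel, Finset.mul_sum]
    exact Finset.sum_congr rfl fun S _ => by ring
  simp_rw [this]
  simp
  ring

/-- flipping one sign -/
def bhFlip {ι : Type*} [DecidableEq ι] (i : ι) (e : ι → ℤˣ) : ι → ℤˣ :=
  Function.update e i (-e i)

lemma bhFlip_invol {ι : Type*} [DecidableEq ι] (i : ι) :
    Function.Involutive (bhFlip i : (ι → ℤˣ) → _) := by
  intro e; simp [bhFlip]

lemma bh_sum_flip {ι : Type*} [Fintype ι] [DecidableEq ι] (i : ι) (F : (ι → ℤˣ) → ℝ) :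
    ∑ e, F (bhFlip i e) = ∑ e, F e :=
  Equiv.sum_comp (bhFlip_invol i).toPerm F

lemma bh_char_flip {ι : Type*} [Fintype ι] [DecidableEq ι] (i : ι) (e : ι → ℤˣ) (S : Finset ι) :
    ∏ j ∈ S, ((bhFlip i e j : ℤ) : ℝ) = (if i ∈ S then -1 else 1) * ∏ j ∈ S, ((e j : ℤ) : ℝ) := by
  split_ifs with h
  · rw [← Finset.mul_prod_erase S _ h, ← Finset.mul_prod_erase S (fun j => ((e j : ℤ) : ℝ)) h]
    have : ∏ j ∈ S.erase i, ((bhFlip i e j : ℤ) : ℝ) = ∏ j ∈ S.erase i, ((e j : ℤ) : ℝ) := by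
      refine Finset.prod_congr rfl fun j hj => ?_
      simp [bhFlip, Function.update_of_ne (Finset.ne_of_mem_erase hj)]
    rw [this]; simp [bhFlip]
  · rw [one_mul]
    refine Finset.prod_congr rfl fun j hj => ?_
    have : j ≠ i := fun h' => h (h' ▸ hj)
    simp [bhFlip, Function.update_of_ne this]

lemma bh_cube {ι : Type*} [Fintype ι] [DecidableEq ι] (f : (ι → ℤˣ) → ℝ)
    (h0 : ∀ e, 0 ≤ f e) (heven : ∀ e, f (-e) = f e)
    (htri : ∀ e, ((Fintype.card ι : ℝ) - 2) * f e ≤ ∑ i, f (bhFlip i e)) :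
    2 ^ Fintype.card ι * ∑ e, f e ^ 2 ≤ 2 * (∑ e, f e) ^ 2 := by
  set F : Finset ι → ℝ := fun S => ∑ e, f e * ∏ i ∈ S, ((e i : ℤ) : ℝ) with hF
  have hodd : ∀ S : Finset ι, S.card = 1 → F S = 0 := by
    intro S hS
    have h1 : F S = ∑ e, f (-e) * ∏ i ∈ S, (((-e) i : ℤ) : ℝ) :=
      (Equiv.sum_comp (Equiv.neg (ι → ℤˣ)) (fun e => f e * ∏ i ∈ S, ((e i : ℤ) : ℝ))).symm
    have h2 : F S = - F S := by
      conv_lhs => rw [h1]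
      simp only [hF]
      rw [← Finset.sum_neg_distrib]
      refine Finset.sum_congr rfl fun e _ => ?_
      rw [heven]
      simp [Finset.prod_neg, hS]
    linarith
  have hG : ∀ S : Finset ι, ∑ e, (∑ i, f (bhFlip i e)) * ∏ i ∈ S, ((e i : ℤ) : ℝ)
      = ((Fintype.card ι : ℝ) - 2 * S.card) * F S := by
    intro S
    simp_rw [Finset.sum_mul]
    rw [Finset.sum_comm]
    have : ∀ i, ∑ e, f (bhFlip i e) * ∏ j ∈ S, ((e j : ℤ) : ℝ) = (if i ∈ S then -1 else 1) * F S := by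
      intro i
      rw [← bh_sum_flip i]
      simp only [hF]
      rw [Finset.mul_sum]
      refine Finset.sum_congr rfl fun e _ => ?_
      rw [bh_char_flip, bhFlip_invol i e]; ring
    simp_rw [this]
    rw [← Finset.sum_mul]
    congr 1
    have : ∀ i, (if i ∈ S then (-1:ℝ) else 1) = 1 - 2 * (if i ∈ S then 1 else 0) := by
      intro i; split_ifs <;> norm_num
    simp_rw [this]
    rw [Finset.sum_sub_distrib, ← Finset.mul_sum]
    simp
  have p1 := bh_parseval f f
  have p2 := bh_parseval f (fun e => ∑ i, f (bhFlip i e))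
  simp_rw [hG] at p2
  have h3 : ((Fintype.card ι : ℝ) - 2) * ∑ e, f e * f e ≤ ∑ e, f e * ∑ i, f (bhFlip i e) := by
    rw [Finset.mul_sum]
    refine Finset.sum_le_sum fun e _ => ?_
    nlinarith [mul_le_mul_of_nonneg_left (htri e) (h0 e)]
  have h4 : ((Fintype.card ι : ℝ) - 2) * ∑ S, F S * F S
      ≤ ∑ S, F S * (((Fintype.card ι : ℝ) - 2 * S.card) * F S) := by
    change ∑ S, F S * F S = _ at p1
    change ∑ S, F S * _ = _ at p2
    rw [p1, p2]
    have : (0:ℝ) < 2 ^ Fintype.card ι := by positivity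
    nlinarith [mul_le_mul_of_nonneg_left h3 this.le]
  have h5 : ∑ S, F S * F S ≤ 2 * (F ∅) ^ 2 := by
    rw [Finset.mul_sum, ← sub_nonneg, ← Finset.sum_sub_distrib] at h4
    have h6 : ∑ S : Finset ι, (F S * (((Fintype.card ι : ℝ) - 2 * S.card) * F S)
        - ((Fintype.card ι : ℝ) - 2) * (F S * F S))
        ≤ ∑ S : Finset ι, ((if S = ∅ then 4 * (F ∅) ^ 2 else 0) - 2 * (F S * F S)) := by
      refine Finset.sum_le_sum fun S _ => ?_
      rcases Nat.lt_or_ge S.card 1 with h | h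
      · have : S = ∅ := by simpa using h
        subst this; simp; nlinarith
      · have hne : S ≠ ∅ := by rintro rfl; simp at h
        rw [if_neg hne]
        rcases h.eq_or_lt with h | h
        · rw [hodd S h.symm]; simp
        · have : (2:ℝ) ≤ S.card := by exact_mod_cast h
          nlinarith [mul_self_nonneg (F S)]
    have h7 := h4.trans h6
    rw [Finset.sum_sub_distrib, Finset.sum_ite_eq', ← Finset.mul_sum] at h7
    simp only [Finset.mem_univ, if_true] at h7
    linarith
  change ∑ S, F S * F S = _ at p1
  rw [p1] at h5
  simpa [hF, pow_two] using h5

lemma bh_orth {ι : Type*} [Fintype ι] [DecidableEq ι] {H : Type*} [NormedAddCommGroup H]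
    [InnerProductSpace ℝ H] (v : ι → H) :
    ∑ e : ι → ℤˣ, ‖∑ i, ((e i : ℤ) : ℝ) • v i‖ ^ 2 = 2 ^ Fintype.card ι * ∑ i, ‖v i‖ ^ 2 := by
  simp_rw [← real_inner_self_eq_norm_sq, sum_inner, inner_sum, real_inner_smul_left,
    real_inner_smul_right]
  rw [Finset.sum_comm, Finset.mul_sum]
  refine Finset.sum_congr rfl fun i _ => ?_
  rw [Finset.sum_comm, Finset.sum_eq_single i]
  · have : ∀ e : ι → ℤˣ, ((e i : ℤ) : ℝ) * (((e i : ℤ) : ℝ) * inner ℝ (v i) (v i)) = inner ℝ (v i) (v i) := by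
      intro e
      rcases Int.units_eq_one_or (e i) with h | h <;> rw [h] <;> norm_num
    simp_rw [this]
    simp
  · intro j _ hj
    have := bh_sum_flip i (fun e : ι → ℤˣ => ((e i : ℤ) : ℝ) * (((e j : ℤ) : ℝ) * inner ℝ (v i) (v j)))
    have h2 : ∀ e : ι → ℤˣ, ((bhFlip i e i : ℤ) : ℝ) * (((bhFlip i e j : ℤ) : ℝ) * inner ℝ (v i) (v j))
       = - (((e i : ℤ) : ℝ) * (((e j : ℤ) : ℝ) * inner ℝ (v i) (v j))) := by
      intro e; simp [bhFlip, Function.update_of_ne hj]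
    simp_rw [h2] at this
    rw [Finset.sum_neg_distrib] at this
    linarith
  · simp

lemma bh_kahane {ι : Type*} [Fintype ι] [DecidableEq ι] {H : Type*} [NormedAddCommGroup H]
    [InnerProductSpace ℝ H] (v : ι → H) :
    2 ^ Fintype.card ι * √(∑ i, ‖v i‖ ^ 2) ≤ √2 * ∑ e : ι → ℤˣ, ‖∑ i, ((e i : ℤ) : ℝ) • v i‖ := by
  have h := bh_cube (fun e : ι → ℤˣ => ‖∑ i, ((e i : ℤ) : ℝ) • v i‖) (fun _ => norm_nonneg _)
    (fun e => by simp [neg_smul, norm_neg]) ?_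
  · rw [bh_orth, ← mul_assoc, ← pow_two] at h
    have := Real.sqrt_le_sqrt h
    rwa [Real.sqrt_mul (by positivity), Real.sqrt_sq (by positivity), Real.sqrt_mul (by positivity),
      Real.sqrt_sq (Finset.sum_nonneg fun _ _ => norm_nonneg _)] at this
  · intro e
    have key : ∀ i, ∑ j, ((bhFlip i e j : ℤ) : ℝ) • v j
        = ∑ j, ((e j : ℤ) : ℝ) • v j - (2 : ℝ) • (((e i : ℤ) : ℝ) • v i) := by
      intro i
      have : ∀ j, ((bhFlip i e j : ℤ) : ℝ) • v j
          = ((e j : ℤ) : ℝ) • v j - if j = i then (2 : ℝ) • (((e j : ℤ) : ℝ) • v j) else 0 := by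
        intro j
        split_ifs with h
        · subst h; simp [bhFlip]; module
        · simp [bhFlip, Function.update_of_ne h]
      simp_rw [this]
      rw [Finset.sum_sub_distrib]; simp
    have h2 : ∑ i, ∑ j, ((bhFlip i e j : ℤ) : ℝ) • v j
        = ((Fintype.card ι : ℝ) - 2) • ∑ j, ((e j : ℤ) : ℝ) • v j := by
      simp_rw [key]
      rw [Finset.sum_sub_distrib, ← Finset.smul_sum, sub_smul]
      simp [Nat.cast_smul_eq_nsmul]
    calc _ ≤ ‖((Fintype.card ι : ℝ) - 2) • ∑ j, ((e j : ℤ) : ℝ) • v j‖ := by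
            rw [norm_smul]
            exact mul_le_mul_of_nonneg_right (le_abs_self _) (norm_nonneg _)
      _ ≤ _ := by rw [← h2]; exact norm_sum_le _ _

lemma bh_step {ι J : Type*} [Fintype ι] [DecidableEq ι] [Fintype J] {H : Type*} [NormedAddCommGroup H]
    [InnerProductSpace ℝ H] (v : ι → J → H) :
    ∃ x : ι → ℝ, (∀ i, |x i| ≤ 1) ∧
      ∑ j, √(∑ i, ‖v i j‖ ^ 2) ≤ √2 * ∑ j, ‖∑ i, x i • v i j‖ := by
  by_contra! hcon
  have h1 : ∑ e : ι → ℤˣ, (√2 * ∑ j, ‖∑ i, ((e i : ℤ) : ℝ) • v i j‖)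
      < ∑ e : ι → ℤˣ, ∑ j, √(∑ i, ‖v i j‖ ^ 2) := by
    refine Finset.sum_lt_sum_of_nonempty Finset.univ_nonempty fun e _ => hcon _ fun i => ?_
    rcases Int.units_eq_one_or (e i) with h | h <;> rw [h] <;> norm_num
  rw [← Finset.mul_sum, Finset.sum_comm, Finset.mul_sum] at h1
  have h2 : ∑ j, 2 ^ Fintype.card ι * √(∑ i, ‖v i j‖ ^ 2)
      ≤ ∑ j, √2 * ∑ e : ι → ℤˣ, ‖∑ i, ((e i : ℤ) : ℝ) • v i j‖ :=
    Finset.sum_le_sum fun j _ => bh_kahane _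
  rw [← Finset.mul_sum] at h2
  simp at h1
  linarith

lemma bh_multi {N : ℕ} {J : Type*} [Fintype J] (k : ℕ)
    (U : MultilinearMap ℝ (fun _ : Fin k => Fin N → ℝ) (J → ℝ)) :
    ∃ x : Fin k → Fin N → ℝ, (∀ l i, |x l i| ≤ 1) ∧
      ∑ j, √(∑ i : Fin k → Fin N, U (fun l => Pi.single (i l) 1) j ^ 2) ≤ √2 ^ k * ∑ j, |U x j| := by
  induction k with
  | zero =>
    refine ⟨0, fun l => l.elim0, ?_⟩
    simp [Real.sqrt_sq_eq_abs]
    refine Finset.sum_le_sum fun j _ => le_of_eq ?_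
    exact congrArg (fun y => |U y j|) (Subsingleton.elim _ _)
  | succ k ih =>
    obtain ⟨x0, hx0, h0⟩ := bh_step (H := EuclideanSpace ℝ (Fin k → Fin N)) (ι := Fin N) (J := J)
      (fun a j => WithLp.toLp 2 fun i => U.curryLeft (Pi.single a 1) (fun l => Pi.single (i l) 1) j)
    obtain ⟨x, hx, h⟩ := ih (U.curryLeft x0)
    refine ⟨Fin.cons x0 x, ?_, ?_⟩
    · intro l
      refine Fin.cases ?_ ?_ l
      · simpa using hx0
      · simpa using hx
    have hsum : x0 = ∑ a, x0 a • (Pi.single a (1:ℝ) : Fin N → ℝ) := by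
      simpa using (pi_eq_sum_univ' x0)
    have e1 : ∀ j, ‖∑ a, x0 a • (WithLp.toLp 2 fun i : Fin k → Fin N => U.curryLeft (Pi.single a 1) (fun l => Pi.single (i l) 1) j : EuclideanSpace ℝ (Fin k → Fin N))‖
        = √(∑ i : Fin k → Fin N, U.curryLeft x0 (fun l => Pi.single (i l) 1) j ^ 2) := by
      intro j
      rw [EuclideanSpace.norm_eq]
      congr 1
      refine Finset.sum_congr rfl fun i _ => ?_
      rw [Real.norm_eq_abs, sq_abs]
      congr 1
      conv_rhs => rw [hsum]
      rw [map_sum]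
      simp only [map_smul]
      simp [WithLp.ofLp_sum]
    have e2 : ∀ j, ∑ i : Fin (k+1) → Fin N, U (fun l => Pi.single (i l) 1) j ^ 2
        = ∑ a, ‖(WithLp.toLp 2 fun i : Fin k → Fin N => U.curryLeft (Pi.single a 1) (fun l => Pi.single (i l) 1) j : EuclideanSpace ℝ (Fin k → Fin N))‖ ^ 2 := by
      intro j
      rw [← Equiv.sum_comp (Fin.consEquiv (fun _ : Fin (k+1) => Fin N)), Fintype.sum_prod_type]
      refine Finset.sum_congr rfl fun a _ => ?_
      rw [EuclideanSpace.norm_sq_eq]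
      refine Finset.sum_congr rfl fun i _ => ?_
      rw [Real.norm_eq_abs, sq_abs]
      simp only [MultilinearMap.curryLeft_apply]
      refine congrArg (fun y => U y j ^ 2) (funext fun l => ?_)
      refine Fin.cases ?_ (fun l => ?_) l <;> simp [Fin.consEquiv]
    simp_rw [e2]
    refine h0.trans ?_
    simp_rw [e1]
    rw [pow_succ', mul_assoc]
    exact mul_le_mul_of_nonneg_left h (Real.sqrt_nonneg _)

lemma bh_blei (m N : ℕ) (hm : 0 < m) (a : (Fin m → Fin N) → ℝ) (M : ℝ) (hM : 0 < M)
    (h : ∀ p : Fin m, ∑ j : Fin N, √(∑ i : Fin m → Fin N, if i p = j then a i ^ 2 else 0) ≤ M) :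
    ∑ i, |a i| ^ (2 * (m : ℝ) / ((m : ℝ) + 1)) ≤ M ^ (2 * (m : ℝ) / ((m : ℝ) + 1)) := by
  set w : Fin m → Fin N → ℝ := fun p j => √(∑ i : Fin m → Fin N, if i p = j then a i ^ 2 else 0)
    with hw
  have hmR : (0:ℝ) < m := by exact_mod_cast hm
  set q : ℝ := 2 * (m : ℝ) / ((m : ℝ) + 1) with hq
  have hqpos : 0 < q := by positivity
  have hw0 : ∀ p j, 0 ≤ w p j := fun p j => Real.sqrt_nonneg _
  have hsq : ∀ p j, (∑ i : Fin m → Fin N, if i p = j then a i ^ 2 else 0) = w p j ^ 2 := by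
    intro p j
    rw [hw, Real.sq_sqrt]
    exact Finset.sum_nonneg fun i _ => by split_ifs <;> positivity
  have hwpos : ∀ i, a i ≠ 0 → ∀ p, 0 < w p (i p) := by
    intro i hi p
    refine Real.sqrt_pos.mpr ?_
    refine lt_of_lt_of_le (b := a i ^ 2) (by positivity) ?_
    have := Finset.single_le_sum (s := Finset.univ)
      (f := fun i' : Fin m → Fin N => if i' p = i p then a i' ^ 2 else 0)
      (fun i' _ => by split_ifs <;> positivity) (Finset.mem_univ i)
    simpa using this
  have hpt : ∀ i, |a i| ^ q ≤ M ^ q *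
      ((1 / ((m:ℝ) + 1)) * (∑ p, a i ^ 2 / (w p (i p) * M) + ∏ p, w p (i p) / M)) := by
    intro i
    have hnn : ∀ p, 0 ≤ a i ^ 2 / (w p (i p) * M) := fun p =>
      div_nonneg (sq_nonneg _) (mul_nonneg (hw0 _ _) hM.le)
    have hnn2 : 0 ≤ ∏ p, w p (i p) / M :=
      Finset.prod_nonneg fun p _ => div_nonneg (hw0 _ _) hM.le
    by_cases hi : a i = 0
    · have := Finset.sum_nonneg fun p (_ : p ∈ Finset.univ) => hnn p
      have hz : |a i| ^ q = 0 := by rw [hi, abs_zero, Real.zero_rpow hqpos.ne']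
      rw [hz]
      positivity
    have hz : ∀ o : Option (Fin m), 0 ≤ o.elim (∏ p, w p (i p) / M)
        (fun p => a i ^ 2 / (w p (i p) * M)) := by
      rintro (_ | p)
      · exact hnn2
      · exact hnn p
    have amgm := Real.geom_mean_le_arith_mean_weighted (Finset.univ : Finset (Option (Fin m)))
      (fun _ => 1 / ((m:ℝ) + 1))
      (fun o => o.elim (∏ p, w p (i p) / M) (fun p => a i ^ 2 / (w p (i p) * M)))
      (fun _ _ => by positivity)
      (by simp; field_simp) (fun o _ => hz o)
    rw [Real.finsetProd_rpow _ _ (fun o _ => hz o), ← Finset.mul_sum, Fintype.prod_option,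
      Fintype.sum_option] at amgm
    simp only [Option.elim] at amgm
    rw [← Finset.prod_mul_distrib] at amgm
    have e : ∀ p, w p (i p) / M * (a i ^ 2 / (w p (i p) * M)) = (|a i| / M) ^ 2 := by
      intro p
      have := (hwpos i hi p).ne'
      rw [div_pow, sq_abs]
      field_simp
    simp_rw [e] at amgm
    rw [Finset.prod_const, Finset.card_univ, Fintype.card_fin, ← pow_mul, ← Real.rpow_natCast,
      ← Real.rpow_mul (by positivity)] at amgm
    have e2 : ((2 * m : ℕ) : ℝ) * (1 / ((m:ℝ) + 1)) = q := by rw [hq]; push_cast; ring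
    rw [e2, Real.div_rpow (abs_nonneg _) hM.le, div_le_iff₀ (by positivity)] at amgm
    rw [add_comm (∑ p, _), mul_comm]
    exact amgm
  refine (Finset.sum_le_sum fun i _ => hpt i).trans ?_
  rw [← Finset.mul_sum, ← Finset.mul_sum, Finset.sum_add_distrib]
  have s1 : ∑ i, ∑ p, a i ^ 2 / (w p (i p) * M) ≤ m := by
    rw [Finset.sum_comm]
    have : ∀ p ∈ Finset.univ, ∑ i, a i ^ 2 / (w p (i p) * M) ≤ 1 := by
      intro p _
      have e : ∑ i, a i ^ 2 / (w p (i p) * M) = (∑ j, w p j) / M := by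
        have e1 : ∀ i : Fin m → Fin N, a i ^ 2 / (w p (i p) * M)
            = ∑ j, (if i p = j then a i ^ 2 else 0) / (w p j * M) := by
          intro i
          rw [Finset.sum_eq_single (i p)]
          · simp
          · intro j _ hj; rw [if_neg (Ne.symm hj)]; simp
          · simp
        simp_rw [e1]
        rw [Finset.sum_comm, Finset.sum_div]
        refine Finset.sum_congr rfl fun j _ => ?_
        rw [← Finset.sum_div, hsq]
        rcases eq_or_ne (w p j) 0 with h0 | h0
        · simp [h0]
        · field_simp
      rw [e, div_le_one hM]
      exact h p
    refine (Finset.sum_le_sum this).trans ?_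
    simp
  have s2 : ∑ i : Fin m → Fin N, ∏ p, w p (i p) / M ≤ 1 := by
    rw [← Fintype.prod_sum (fun p j => w p j / M)]
    refine Finset.prod_le_one (fun p _ => Finset.sum_nonneg fun j _ => div_nonneg (hw0 _ _) hM.le) ?_
    intro p _
    rw [← Finset.sum_div, div_le_one hM]
    exact h p
  have : (1 / ((m:ℝ) + 1)) * (∑ i, ∑ p, a i ^ 2 / (w p (i p) * M)
      + ∑ i : Fin m → Fin N, ∏ p, w p (i p) / M) ≤ 1 := by
    rw [one_div, inv_mul_le_iff₀ (by positivity)]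
    linarith
  exact mul_le_of_le_one_right (by positivity) this

lemma bh_mixed (n N : ℕ) (U : ContinuousMultilinearMap ℝ (fun _ : Fin (n + 1) => Fin N → ℝ) ℝ)
    (p : Fin (n + 1)) :
    ∑ j : Fin N, √(∑ i : Fin (n + 1) → Fin N,
      if i p = j then U (fun k => Pi.single (i k) 1) ^ 2 else 0) ≤ √2 ^ n * ‖U‖ := by
  obtain ⟨x, hx, h⟩ := bh_multi (J := Fin N) n
    (MultilinearMap.pi fun j => U.toMultilinearMap.curryMid p (Pi.single j 1))
  simp only [MultilinearMap.pi_apply, MultilinearMap.curryMid_apply_apply] at h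
  have e : ∀ j : Fin N, (∑ i : Fin (n + 1) → Fin N,
      if i p = j then U (fun k => Pi.single (i k) 1) ^ 2 else 0)
      = ∑ i : Fin n → Fin N, U.toMultilinearMap (p.insertNth (Pi.single j 1)
          (fun l => Pi.single (i l) 1)) ^ 2 := by
    intro j
    rw [← Equiv.sum_comp (Fin.insertNthEquiv (fun _ : Fin (n+1) => Fin N) p),
      Fintype.sum_prod_type, Finset.sum_eq_single j]
    · refine Finset.sum_congr rfl fun i _ => ?_
      simp only [Fin.insertNthEquiv, Equiv.coe_fn_mk, Fin.insertNth_apply_same, if_true]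
      refine congrArg (fun y => U y ^ 2) (funext fun l => ?_)
      refine Fin.succAboveCases p ?_ (fun l => ?_) l <;> simp
    · intro b _ hb
      simp [Fin.insertNthEquiv, hb]
    · simp
  simp_rw [e]
  refine h.trans (mul_le_mul_of_nonneg_left ?_ (by positivity))
  set s : Fin N → ℝ := fun j => SignType.sign (U.toMultilinearMap (p.insertNth (Pi.single j 1) x))
  have hs : s = ∑ j, s j • (Pi.single j (1:ℝ) : Fin N → ℝ) := by
    simpa using (pi_eq_sum_univ' s)
  have e3 : ∑ j, |U.toMultilinearMap (p.insertNth (Pi.single j 1) x)|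
      = U.toMultilinearMap (p.insertNth s x) := by
    rw [← MultilinearMap.curryMid_apply_apply, hs, map_sum]
    simp only [map_smul]
    simp [s, sign_mul_self]
  rw [e3]
  have hle := U.le_opNorm (p.insertNth s x)
  refine (le_abs_self _).trans (hle.trans ?_)
  refine mul_le_of_le_one_right (norm_nonneg _) (Finset.prod_le_one (fun _ _ => norm_nonneg _) ?_)
  intro l _
  refine (pi_norm_le_iff_of_nonneg zero_le_one).mpr fun i => ?_
  refine Fin.succAboveCases p ?_ (fun l => ?_) l
  · simp only [Fin.insertNth_apply_same, s, Real.norm_eq_abs]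
    generalize SignType.sign (U.toMultilinearMap (p.insertNth (Pi.single i 1) x)) = t
    cases t <;> simp
  · simpa using hx l i


theorem stmt_12 (m N : ℕ) (hm : 0 < m) (hN : 0 < N)
    (U : ContinuousMultilinearMap ℝ (fun _ : Fin m => Fin N → ℝ) ℝ) :
    (∑ i : Fin m → Fin N,
        |U (fun k => Pi.single (i k) 1)| ^ (2 * (m : ℝ) / ((m : ℝ) + 1)))
          ^ (((m : ℝ) + 1) / (2 * (m : ℝ)))
      ≤ 2 ^ (((m : ℝ) - 1) / 2) * ‖U‖ := by
  obtain ⟨n, rfl⟩ : ∃ n, m = n + 1 := ⟨m - 1, by omega⟩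
  have hmR : (0:ℝ) < ((n + 1 : ℕ) : ℝ) := by positivity
  rcases (norm_nonneg U).eq_or_lt with h0 | hpos
  · have hU : U = 0 := norm_eq_zero.mp h0.symm
    subst hU
    have h1 : (2 * ((n + 1 : ℕ) : ℝ) / (((n + 1 : ℕ) : ℝ) + 1)) ≠ 0 := by positivity
    have h2 : ((((n + 1 : ℕ) : ℝ) + 1) / (2 * ((n + 1 : ℕ) : ℝ))) ≠ 0 := by positivity
    simp only [ContinuousMultilinearMap.zero_apply, abs_zero, Real.zero_rpow h1,
      Finset.sum_const_zero, Real.zero_rpow h2, norm_zero, mul_zero, le_refl]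
  · have hM : 0 < √2 ^ n * ‖U‖ := by positivity
    have key := bh_blei (n + 1) N hm (fun i => U (fun k => Pi.single (i k) 1)) _ hM
      (bh_mixed n N U)
    have := Real.rpow_le_rpow (Finset.sum_nonneg fun i _ => by positivity) key
      (z := (((n + 1 : ℕ) : ℝ) + 1) / (2 * ((n + 1 : ℕ) : ℝ))) (by positivity)
    refine this.trans (le_of_eq ?_)
    rw [← Real.rpow_mul hM.le]
    have e1 : (2 * ((n + 1 : ℕ) : ℝ) / (((n + 1 : ℕ) : ℝ) + 1))
        * ((((n + 1 : ℕ) : ℝ) + 1) / (2 * ((n + 1 : ℕ) : ℝ))) = 1 := by field_simp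
    rw [e1, Real.rpow_one]
    congr 1
    rw [Real.sqrt_eq_rpow, ← Real.rpow_natCast, ← Real.rpow_mul (by norm_num)]
    congr 1
    push_cast
    ring
end

section
/- For every positive integer N and every trilinear form U : ℓ_∞^N × ℓ_∞^N × ℓ_∞^N → ℝ, (Σ_{i,j,k=1}^N |U(e_i, e_j, e_k)|^{3/2})^{2/3} ≤ 2^{5/6} ‖U‖. -/
set_option linter.unusedSectionVars false
namespace BH3

/-- real value of a sign -/
noncomputable def sg (u : ℤˣ) : ℝ := ((u : ℤ) : ℝ)

lemma sg_mul (u v : ℤˣ) : sg (u * v) = sg u * sg v := by simp [sg]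
lemma sg_one : sg 1 = 1 := by simp [sg]
lemma sg_neg_one : sg (-1) = -1 := by simp [sg]
lemma sg_cases (u : ℤˣ) : sg u = 1 ∨ sg u = -1 := by
  rcases Int.units_eq_one_or u with h | h <;> simp [h, sg]
lemma sg_sq (u : ℤˣ) : sg u * sg u = 1 := by
  rcases sg_cases u with h | h <;> simp [h]
lemma sg_abs (u : ℤˣ) : |sg u| = 1 := by
  rcases sg_cases u with h | h <;> simp [h]
lemma exists_sg (r : ℝ) : ∃ u : ℤˣ, sg u * r = |r| := by
  rcases le_total 0 r with h | h
  · exact ⟨1, by simp [sg_one, abs_of_nonneg h]⟩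
  · exact ⟨-1, by simp [sg_neg_one, abs_of_nonpos h]⟩

variable {ι : Type*} [Fintype ι] [DecidableEq ι]

/-- Walsh functions -/
noncomputable def w (S : Finset ι) (x : ι → ℤˣ) : ℝ := ∏ i ∈ S, sg (x i)

lemma w_mul (S : Finset ι) (x y : ι → ℤˣ) : w S (x * y) = w S x * w S y := by
  simp [w, sg_mul, Finset.prod_mul_distrib]

/-- flip at a coordinate -/
def fl (i : ι) : ι → ℤˣ := Pi.mulSingle i (-1)

lemma fl_mul_fl (i : ι) : fl i * fl i = (1 : ι → ℤˣ) := by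
  simp [fl, ← Pi.mulSingle_mul]

lemma w_fl (S : Finset ι) (i : ι) : w S (fl i) = if i ∈ S then -1 else 1 := by
  have : ∀ j, sg (fl i j) = if j = i then -1 else 1 := by
    intro j
    by_cases h : j = i
    · subst h; simp [fl, sg_neg_one]
    · simp [fl, h, sg_one]
  simp only [w, this]
  simp [Finset.prod_ite_eq']

lemma sum_w_fl (S : Finset ι) : ∑ i, w S (fl i) = (Fintype.card ι : ℝ) - 2 * S.card := by
  have : ∀ i, w S (fl i) = 1 - 2 * (if i ∈ S then 1 else 0) := by
    intro i; rw [w_fl]; split_ifs <;> norm_num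
  simp only [this, Finset.sum_sub_distrib, ← Finset.mul_sum]
  simp

lemma kernel (x y : ι → ℤˣ) :
    ∑ S : Finset ι, w S x * w S y = if x = y then (Fintype.card (ι → ℤˣ) : ℝ) else 0 := by
  have h : ∑ S : Finset ι, w S x * w S y = ∏ i, (1 + sg (x i) * sg (y i)) := by
    rw [Finset.prod_one_add]
    simp [w, Finset.prod_mul_distrib]
  rw [h]
  split_ifs with hxy
  · subst hxy
    simp only [sg_sq]
    simp
    norm_num
  · obtain ⟨i, hi⟩ := Function.ne_iff.mp hxy
    apply Finset.prod_eq_zero (Finset.mem_univ i)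
    rcases Int.units_eq_one_or (x i) with h | h <;> rcases Int.units_eq_one_or (y i) with h' | h' <;>
      simp_all [sg]

/-- unnormalized Walsh coefficient -/
noncomputable def co (f : (ι → ℤˣ) → ℝ) (S : Finset ι) : ℝ := ∑ x, f x * w S x

lemma parseval (f g : (ι → ℤˣ) → ℝ) :
    ∑ S, co f S * co g S = (Fintype.card (ι → ℤˣ) : ℝ) * ∑ x, f x * g x := by
  calc ∑ S, co f S * co g S
      = ∑ S : Finset ι, ∑ x, ∑ y, f x * g y * (w S x * w S y) := by
        refine Finset.sum_congr rfl fun S _ => ?_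
        rw [co, co, Finset.sum_mul_sum]
        refine Finset.sum_congr rfl fun x _ => Finset.sum_congr rfl fun y _ => ?_
        ring
    _ = ∑ x, ∑ y, f x * g y * ∑ S : Finset ι, (w S x * w S y) := by
        rw [Finset.sum_comm]
        refine Finset.sum_congr rfl fun x _ => ?_
        rw [Finset.sum_comm]
        refine Finset.sum_congr rfl fun y _ => ?_
        rw [Finset.mul_sum]
    _ = _ := by
        simp only [kernel]
        rw [Finset.mul_sum]
        refine Finset.sum_congr rfl fun x _ => ?_
        simp
        ring

lemma sum_fl (g : (ι → ℤˣ) → ℝ) (i : ι) : ∑ x, g (x * fl i) = ∑ x, g x :=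
  Equiv.sum_comp (Equiv.mulRight (fl i)) g

lemma co_fl (f : (ι → ℤˣ) → ℝ) (i : ι) (S : Finset ι) :
    co (fun x => f (x * fl i)) S = w S (fl i) * co f S := by
  rw [co, ← sum_fl _ i, co, Finset.mul_sum]
  refine Finset.sum_congr rfl fun x _ => ?_
  rw [mul_assoc x, fl_mul_fl, mul_one, w_mul]; ring

lemma co_single (f : (ι → ℤˣ) → ℝ) (hf : ∀ x, f (-x) = f x) (i : ι) : co f {i} = 0 := by
  have h : co f {i} = - co f {i} := by
    conv_lhs => rw [co, ← Equiv.sum_comp (Equiv.neg _)]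
    rw [co, ← Finset.sum_neg_distrib]
    refine Finset.sum_congr rfl fun x _ => ?_
    simp [hf, w, sg]
  linarith

/-- Rademacher sum over a finset -/
noncomputable def rs (a : ι → ℝ) (s : Finset ι) (x : ι → ℤˣ) : ℝ := ∑ i ∈ s, a i * sg (x i)

lemma sg_fl (x : ι → ℤˣ) (i j : ι) : sg ((x * fl i) j) = if j = i then - sg (x j) else sg (x j) := by
  rw [Pi.mul_apply, sg_mul]
  by_cases h : j = i
  · subst h; simp [fl, sg_neg_one]
  · simp [fl, h, sg_one]

lemma rs_fl_mem (a : ι → ℝ) (x : ι → ℤˣ) (i : ι) :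
    rs a Finset.univ (x * fl i) = rs a Finset.univ x - 2 * (a i * sg (x i)) := by
  have : ∀ j, a j * sg ((x * fl i) j) = a j * sg (x j) - if j = i then 2 * (a j * sg (x j)) else 0 := by
    intro j; rw [sg_fl]; split_ifs <;> ring
  simp only [rs, this, Finset.sum_sub_distrib]
  simp

lemma rs_fl_not_mem (a : ι → ℝ) (s : Finset ι) (x : ι → ℤˣ) (i : ι) (hi : i ∉ s) :
    rs a s (x * fl i) = rs a s x := by
  refine Finset.sum_congr rfl fun j hj => ?_
  rw [sg_fl, if_neg]
  rintro rfl; exact hi hj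

lemma khin_one_aux (a : ι → ℝ) :
    (Fintype.card (ι → ℤˣ) : ℝ) * ∑ x, (rs a Finset.univ x) ^ 2
      ≤ 2 * (∑ x, |rs a Finset.univ x|) ^ 2 := by
  set f : (ι → ℤˣ) → ℝ := fun x => |rs a Finset.univ x| with hfdef
  set T : ℝ := (Fintype.card (ι → ℤˣ) : ℝ) with hT
  have hTpos : 0 ≤ T := Nat.cast_nonneg _
  set n : ℝ := (Fintype.card ι : ℝ) with hn
  have heven : ∀ x, f (-x) = f x := by
    intro x
    have : rs a Finset.univ (-x) = - rs a Finset.univ x := by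
      simp [rs, sg]
    simp [f, this]
  have hsq : ∑ x, (rs a Finset.univ x) ^ 2 = ∑ x, f x * f x := by
    refine Finset.sum_congr rfl fun x _ => ?_
    simp only [f, abs_mul_abs_self]; ring
  have hpt : ∀ x, (n - 2) * (f x * f x) ≤ ∑ i, f (x * fl i) * f x := by
    intro x
    rw [← Finset.sum_mul, ← mul_assoc]
    refine mul_le_mul_of_nonneg_right ?_ (abs_nonneg _)
    calc (n - 2) * f x ≤ |(n - 2) * rs a Finset.univ x| := by
          rw [abs_mul]; exact mul_le_mul_of_nonneg_right (le_abs_self _) (abs_nonneg _)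
      _ = |∑ i, rs a Finset.univ (x * fl i)| := by
          congr 1
          simp only [rs_fl_mem, Finset.sum_sub_distrib, ← Finset.mul_sum]
          simp [rs, hn]; ring
      _ ≤ _ := Finset.abs_sum_le_sum_abs _ _
  have h1 : T * ((n - 2) * ∑ x, f x * f x) ≤ ∑ S, (n - 2 * (S.card : ℝ)) * (co f S * co f S) := by
    calc T * ((n - 2) * ∑ x, f x * f x) ≤ T * ∑ x, ∑ i, f (x * fl i) * f x := by
          refine mul_le_mul_of_nonneg_left ?_ hTpos
          rw [Finset.mul_sum]
          exact Finset.sum_le_sum fun x _ => hpt x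
      _ = ∑ i, T * ∑ x, f (x * fl i) * f x := by
          rw [Finset.sum_comm, Finset.mul_sum]
      _ = ∑ i, ∑ S, w S (fl i) * (co f S * co f S) := by
          refine Finset.sum_congr rfl fun i _ => ?_
          rw [hT, ← parseval (fun x => f (x * fl i)) f]
          refine Finset.sum_congr rfl fun S _ => ?_
          rw [co_fl]; ring
      _ = _ := by
          rw [Finset.sum_comm]
          refine Finset.sum_congr rfl fun S _ => ?_
          rw [← Finset.sum_mul, sum_w_fl]
  have h2 : ∑ S, (n - 2 * (S.card : ℝ)) * (co f S * co f S)
      ≤ ∑ S, ((n - 4) * (co f S * co f S) + if S = ∅ then 4 * (co f S * co f S) else 0) := by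
    refine Finset.sum_le_sum fun S _ => ?_
    by_cases h0 : S = ∅
    · subst h0; simp; linarith
    · rw [if_neg h0]
      by_cases hc : S.card = 1
      · obtain ⟨i, rfl⟩ := Finset.card_eq_one.mp hc
        rw [co_single f heven]; simp
      · have hc2 : 2 ≤ S.card := by
          have := Finset.card_ne_zero.mpr (Finset.nonempty_iff_ne_empty.mpr h0)
          omega
        have hc3 : (2 : ℝ) ≤ S.card := by exact_mod_cast hc2
        nlinarith [mul_self_nonneg (co f S)]
  rw [Finset.sum_add_distrib, ← Finset.mul_sum, parseval f f, Finset.sum_ite_eq' Finset.univ] at h2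
  have h0 : co f ∅ = ∑ x, f x := by simp [co, w]
  rw [hsq]
  simp only [Finset.mem_univ, if_true, h0] at h2
  nlinarith

/-- average over signs -/
noncomputable def Ex (g : (ι → ℤˣ) → ℝ) : ℝ := (∑ x, g x) / (Fintype.card (ι → ℤˣ) : ℝ)

lemma card_pos' : (0 : ℝ) < (Fintype.card (ι → ℤˣ) : ℝ) := by
  exact_mod_cast Fintype.card_pos

lemma Ex_mono {f g : (ι → ℤˣ) → ℝ} (h : ∀ x, f x ≤ g x) : Ex f ≤ Ex g :=
  div_le_div_of_nonneg_right (Finset.sum_le_sum fun x _ => h x) card_pos'.le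

lemma Ex_add (f g : (ι → ℤˣ) → ℝ) : Ex (fun x => f x + g x) = Ex f + Ex g := by
  simp [Ex, Finset.sum_add_distrib, add_div]

lemma Ex_smul (c : ℝ) (g : (ι → ℤˣ) → ℝ) : Ex (fun x => c * g x) = c * Ex g := by
  simp [Ex, ← Finset.mul_sum, mul_div_assoc]

lemma Ex_const (c : ℝ) : Ex (fun _ : ι → ℤˣ => c) = c := by
  have := (card_pos' (ι := ι)).ne'
  rw [Ex, Finset.sum_const, Finset.card_univ, nsmul_eq_mul]
  field_simp

lemma Ex_sum {κ : Type*} (s : Finset κ) (g : κ → (ι → ℤˣ) → ℝ) :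
    Ex (fun x => ∑ k ∈ s, g k x) = ∑ k ∈ s, Ex (g k) := by
  simp only [Ex]
  rw [Finset.sum_comm, Finset.sum_div]

lemma Ex_fl (g : (ι → ℤˣ) → ℝ) (i : ι) : Ex (fun x => g (x * fl i)) = Ex g := by
  rw [Ex, sum_fl, Ex]

lemma rs_insert_fl (a : ι → ℝ) (s : Finset ι) (x : ι → ℤˣ) (i : ι) (hi : i ∉ s) :
    rs a (insert i s) (x * fl i) = rs a s x - a i * sg (x i) := by
  have := rs_fl_not_mem a s x i hi
  rw [rs, Finset.sum_insert hi]
  rw [rs] at this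
  rw [this, sg_fl]; simp; ring

lemma rs_insert (a : ι → ℝ) (s : Finset ι) (x : ι → ℤˣ) (i : ι) (hi : i ∉ s) :
    rs a (insert i s) x = rs a s x + a i * sg (x i) := by
  rw [rs, Finset.sum_insert hi, rs]; ring

lemma moment_two (a : ι → ℝ) (s : Finset ι) : Ex (fun x => rs a s x ^ 2) = ∑ i ∈ s, a i ^ 2 := by
  induction s using Finset.induction_on with
  | empty => simp [rs, Ex]
  | insert i s hi ih =>
    have h := Ex_fl (fun x => rs a (insert i s) x ^ 2) i
    have h2 : Ex (fun x => rs a (insert i s) (x * fl i) ^ 2 + rs a (insert i s) x ^ 2)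
        = Ex (fun x => 2 * rs a s x ^ 2 + 2 * a i ^ 2) := by
      congr 1; funext x
      rw [rs_insert_fl _ _ _ _ hi, rs_insert _ _ _ _ hi]
      linear_combination (2 * a i ^ 2) * sg_sq (x i)
    rw [Ex_add, Ex_add, Ex_smul, Ex_const, ih, h] at h2
    rw [Finset.sum_insert hi]; linarith

lemma moment_four (a : ι → ℝ) (s : Finset ι) :
    Ex (fun x => rs a s x ^ 4) ≤ 3 * (∑ i ∈ s, a i ^ 2) ^ 2 := by
  induction s using Finset.induction_on with
  | empty => simp [rs, Ex]
  | insert i s hi ih =>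
    have h := Ex_fl (fun x => rs a (insert i s) x ^ 4) i
    have h2 : Ex (fun x => rs a (insert i s) (x * fl i) ^ 4 + rs a (insert i s) x ^ 4)
        = Ex (fun x => 2 * rs a s x ^ 4 + ((12 * a i ^ 2) * rs a s x ^ 2 + 2 * a i ^ 4)) := by
      congr 1; funext x
      rw [rs_insert_fl _ _ _ _ hi, rs_insert _ _ _ _ hi]
      linear_combination (12 * a i ^ 2 * rs a s x ^ 2 + 2 * a i ^ 4 * (sg (x i) * sg (x i) + 1)) * sg_sq (x i)
    rw [Ex_add, Ex_add, Ex_add, Ex_smul, Ex_smul, Ex_const, moment_two, h] at h2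
    rw [Finset.sum_insert hi]
    have : 0 ≤ ∑ i ∈ s, a i ^ 2 := Finset.sum_nonneg fun i _ => sq_nonneg _
    nlinarith [sq_nonneg (a i ^ 2)]

lemma khin_one (a : ι → ℝ) :
    ∑ i, a i ^ 2 ≤ 2 * (Ex (fun x => |rs a Finset.univ x|)) ^ 2 := by
  rw [← moment_two a Finset.univ]
  have h := khin_one_aux a
  have hp := (card_pos' (ι := ι))
  simp only [Ex]
  rw [div_pow, ← mul_div_assoc, div_le_div_iff₀ hp (by positivity)]
  nlinarith

lemma poly_ineq (v : ℝ) (hv : 0 ≤ v) :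
    440 * v ^ 2 + 3240 * v ≤ v ^ 4 + 3087 * v ^ ((4 : ℝ) / 3) + 592 := by
  obtain ⟨u, hu, rfl⟩ : ∃ u : ℝ, 0 ≤ u ∧ v = u ^ 3 :=
    ⟨v ^ ((1 : ℝ) / 3), by positivity, by
      rw [← Real.rpow_natCast, ← Real.rpow_mul hv]; norm_num⟩
  have : (u ^ 3) ^ ((4 : ℝ) / 3) = u ^ 4 := by
    rw [← Real.rpow_natCast, ← Real.rpow_mul hu, ← Real.rpow_natCast]; norm_num
  rw [this]
  have key : 0 ≤ ((u - 1) * (u - 2)) ^ 2 * (148 + 444 * u + 851 * u ^ 2 + 522 * u ^ 3 + 201 * u ^ 4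
      + 72 * u ^ 5 + 23 * u ^ 6 + 6 * u ^ 7 + u ^ 8) := by positivity
  nlinarith [key]

lemma khin_four_thirds (a : ι → ℝ) :
    (3 / 4) * (∑ i, a i ^ 2) ^ ((2 : ℝ) / 3)
      ≤ Ex (fun x => |rs a Finset.univ x| ^ ((4 : ℝ) / 3)) := by
  have hnn : 0 ≤ ∑ i, a i ^ 2 := Finset.sum_nonneg fun i _ => sq_nonneg _
  rcases hnn.eq_or_lt with h0 | hpos
  · rw [← h0, Real.zero_rpow (by norm_num), mul_zero, Ex]
    positivity
  set q := ∑ i, a i ^ 2 with hq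
  set σ := Real.sqrt q with hσ
  have hσp : 0 < σ := Real.sqrt_pos.mpr hpos
  have hσ2 : σ ^ 2 = q := Real.sq_sqrt hnn
  have hq23 : q ^ ((2 : ℝ) / 3) = σ ^ ((4 : ℝ) / 3) := by
    rw [← hσ2, ← Real.rpow_natCast, ← Real.rpow_mul hσp.le]; norm_num
  set c := (27 / 8) / σ with hc
  have hcp : 0 < c := by positivity
  have hcσ : c * σ = 27 / 8 := by rw [hc]; field_simp
  have hcr : c ^ ((4 : ℝ) / 3) * σ ^ ((4 : ℝ) / 3) = 81 / 16 := by
    rw [← Real.mul_rpow hcp.le hσp.le, hcσ]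
    rw [show (27 / 8 : ℝ) = (3 / 2) ^ (3 : ℝ) by norm_num, ← Real.rpow_mul (by norm_num)]
    norm_num
  have hmono := Ex_mono (ι := ι) (fun x => poly_ineq (c * |rs a Finset.univ x|) (by positivity))
  have hfun : (fun x => (c * |rs a Finset.univ x|) ^ 4
        + 3087 * (c * |rs a Finset.univ x|) ^ ((4 : ℝ) / 3) + 592)
      = fun x => (c ^ 4 * rs a Finset.univ x ^ 4
        + (3087 * c ^ ((4 : ℝ) / 3)) * |rs a Finset.univ x| ^ ((4 : ℝ) / 3)) + 592 := by
    funext x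
    rw [Real.mul_rpow hcp.le (abs_nonneg _), mul_pow, Even.pow_abs (by decide)]; ring
  have hfun2 : (fun x => 440 * (c * |rs a Finset.univ x|) ^ 2 + 3240 * (c * |rs a Finset.univ x|))
      = fun x => (440 * c ^ 2) * rs a Finset.univ x ^ 2 + (3240 * c) * |rs a Finset.univ x| := by
    funext x
    rw [mul_pow, sq_abs]; ring
  rw [hfun, hfun2, Ex_add, Ex_add, Ex_add, Ex_smul, Ex_smul, Ex_smul, Ex_smul, Ex_const,
    moment_two, ← hq] at hmono
  have h4 := moment_four a Finset.univ
  rw [← hq] at h4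
  have h1 := khin_one a
  rw [← hq] at h1
  set E1 := Ex (fun x => |rs a Finset.univ x|) with hE1
  set E4 := Ex (fun x => rs a Finset.univ x ^ 4) with hE4
  set E3 := Ex (fun x => |rs a Finset.univ x| ^ ((4 : ℝ) / 3)) with hE3
  have hE1n : 0 ≤ E1 := by rw [hE1, Ex]; positivity
  have hE1b : 0.707 * σ ≤ E1 := by
    refine abs_le_of_sq_le_sq' ?_ hE1n |>.2
    nlinarith
  have e1 : 440 * c ^ 2 * q = 440 * (27 / 8) ^ 2 := by rw [← hσ2, ← hcσ]; ring
  have e2 : 3240 * (27 / 8) * 0.707 ≤ 3240 * c * E1 := by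
    calc 3240 * (27 / 8) * 0.707 = 3240 * c * (0.707 * σ) := by rw [← hcσ]; ring
      _ ≤ _ := by gcongr
  have e4 : c ^ 4 * E4 ≤ 3 * (27 / 8) ^ 4 := by
    calc c ^ 4 * E4 ≤ c ^ 4 * (3 * q ^ 2) := by gcongr
      _ = _ := by rw [← hσ2, ← hcσ]; ring
  rw [hq23]
  have hcrp : 0 < c ^ ((4 : ℝ) / 3) := by positivity
  refine le_of_mul_le_mul_left ?_ hcrp
  norm_num at e1 e2 e4
  nlinarith

end BH3

namespace BH3

lemma holder3 {α : Type*} (s : Finset α) (f g h : α → ℝ) (p q r : ℝ) (hp : 0 < p) (hq : 0 < q)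
    (hr : 0 < r) (hsum : p + q + r = 1) (hf : ∀ i, 0 ≤ f i) (hg : ∀ i, 0 ≤ g i)
    (hh : ∀ i, 0 ≤ h i) :
    ∑ i ∈ s, f i ^ p * g i ^ q * h i ^ r
      ≤ (∑ i ∈ s, f i) ^ p * (∑ i ∈ s, g i) ^ q * (∑ i ∈ s, h i) ^ r := by
  have hF : 0 ≤ ∑ i ∈ s, f i := Finset.sum_nonneg fun i _ => hf i
  have hG : 0 ≤ ∑ i ∈ s, g i := Finset.sum_nonneg fun i _ => hg i
  have hH : 0 ≤ ∑ i ∈ s, h i := Finset.sum_nonneg fun i _ => hh i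
  have triv : (∀ i ∈ s, f i ^ p * g i ^ q * h i ^ r = 0) →
      ∑ i ∈ s, f i ^ p * g i ^ q * h i ^ r
      ≤ (∑ i ∈ s, f i) ^ p * (∑ i ∈ s, g i) ^ q * (∑ i ∈ s, h i) ^ r := by
    intro h0
    rw [Finset.sum_eq_zero h0]
    positivity
  rcases hF.eq_or_lt with h0 | hF'
  · apply triv
    intro i hi
    rw [(Finset.sum_eq_zero_iff_of_nonneg fun i _ => hf i).mp h0.symm i hi,
      Real.zero_rpow hp.ne']; ring
  rcases hG.eq_or_lt with h0 | hG'
  · apply triv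
    intro i hi
    rw [(Finset.sum_eq_zero_iff_of_nonneg fun i _ => hg i).mp h0.symm i hi,
      Real.zero_rpow hq.ne']; ring
  rcases hH.eq_or_lt with h0 | hH'
  · apply triv
    intro i hi
    rw [(Finset.sum_eq_zero_iff_of_nonneg fun i _ => hh i).mp h0.symm i hi,
      Real.zero_rpow hr.ne']; ring
  set F := ∑ i ∈ s, f i with hFd
  set G := ∑ i ∈ s, g i with hGd
  set H := ∑ i ∈ s, h i with hHd
  have hpt : ∀ i ∈ s, f i ^ p * g i ^ q * h i ^ r
      ≤ (F ^ p * G ^ q * H ^ r) * (p * (f i / F) + q * (g i / G) + r * (h i / H)) := by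
    intro i _
    have := Real.geom_mean_le_arith_mean3_weighted hp.le hq.le hr.le
      (div_nonneg (hf i) hF) (div_nonneg (hg i) hG) (div_nonneg (hh i) hH) hsum
    rw [Real.div_rpow (hf i) hF, Real.div_rpow (hg i) hG, Real.div_rpow (hh i) hH] at this
    have hP : 0 < F ^ p * G ^ q * H ^ r := by positivity
    refine le_trans (le_of_eq ?_) (mul_le_mul_of_nonneg_left this hP.le)
    have := (Real.rpow_pos_of_pos hF' p).ne'
    have := (Real.rpow_pos_of_pos hG' q).ne'
    have := (Real.rpow_pos_of_pos hH' r).ne'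
    field_simp
  refine (Finset.sum_le_sum hpt).trans (le_of_eq ?_)
  rw [← Finset.mul_sum, Finset.sum_add_distrib, Finset.sum_add_distrib, ← Finset.mul_sum,
    ← Finset.mul_sum, ← Finset.mul_sum, ← Finset.sum_div, ← Finset.sum_div, ← Finset.sum_div,
    ← hFd, ← hGd, ← hHd, div_self hF'.ne', div_self hG'.ne', div_self hH'.ne']
  linear_combination (F ^ p * G ^ q * H ^ r) * hsum

lemma minkowski {α β : Type*} (s : Finset α) (t : Finset β) (v : α → β → ℝ)
    (hv : ∀ i k, 0 ≤ v i k) (p : ℝ) (hp : 1 ≤ p) :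
    (∑ i ∈ s, (∑ k ∈ t, v i k) ^ p) ^ (1 / p) ≤ ∑ k ∈ t, (∑ i ∈ s, v i k ^ p) ^ (1 / p) := by
  classical
  induction t using Finset.induction_on with
  | empty =>
    simp only [Finset.sum_empty]
    rw [Real.zero_rpow (by linarith), Finset.sum_const_zero, Real.zero_rpow (by positivity)]
  | insert k t hk ih =>
    simp only [Finset.sum_insert hk]
    refine (Real.Lp_add_le_of_nonneg s hp (fun i _ => hv i k)
      (fun i _ => Finset.sum_nonneg fun k _ => hv i k)).trans ?_
    gcongr

variable {ι κ μ : Type*} [Fintype ι] [DecidableEq ι] [Fintype κ] [DecidableEq κ]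
  [Fintype μ] [DecidableEq μ]

lemma bil_one (b : ι → κ → ℝ) (K : ℝ)
    (H : ∀ (x : ι → ℤˣ) (y : κ → ℤˣ), ∑ i, ∑ j, b i j * sg (x i) * sg (y j) ≤ K) :
    ∑ i, (∑ j, b i j ^ 2) ^ ((1 : ℝ) / 2) ≤ Real.sqrt 2 * K := by
  have h1 : ∀ y : κ → ℤˣ, ∑ i, |rs (b i) Finset.univ y| ≤ K := by
    intro y
    choose x hx using fun i => exists_sg (rs (b i) Finset.univ y)
    refine le_trans (le_of_eq ?_) (H x y)
    refine Finset.sum_congr rfl fun i _ => ?_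
    rw [← hx i, rs, Finset.mul_sum]
    refine Finset.sum_congr rfl fun j _ => ?_
    ring
  have h2 := Ex_mono h1
  rw [Ex_const, Ex_sum] at h2
  refine le_trans ?_ (mul_le_mul_of_nonneg_left h2 (Real.sqrt_nonneg 2))
  rw [Finset.mul_sum]
  refine Finset.sum_le_sum fun i _ => ?_
  rw [← Real.sqrt_eq_rpow]
  apply Real.sqrt_le_iff.mpr
  constructor
  · rw [Ex]; positivity
  · rw [mul_pow, Real.sq_sqrt (by norm_num)]
    exact khin_one (b i)

lemma bil_comb (b : ι → κ → ℝ) (hb : ∀ i j, 0 ≤ b i j) (K : ℝ)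
    (h1 : ∑ i, (∑ j, b i j ^ 2) ^ ((1 : ℝ) / 2) ≤ K)
    (h2 : ∑ j, (∑ i, b i j ^ 2) ^ ((1 : ℝ) / 2) ≤ K) :
    ∑ i, ∑ j, b i j ^ ((4 : ℝ) / 3) ≤ K ^ ((4 : ℝ) / 3) := by
  have n1 : ∀ i, 0 ≤ ∑ j, b i j ^ 2 := fun i => Finset.sum_nonneg fun j _ => sq_nonneg _
  have n2 : ∀ i, 0 ≤ ∑ j, b i j := fun i => Finset.sum_nonneg fun j _ => hb i j
  have hK : 0 ≤ K := le_trans (Finset.sum_nonneg fun i _ => Real.rpow_nonneg (n1 i) _) h1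
  have s1 : ∀ i, ∑ j, b i j ^ ((4 : ℝ) / 3)
      ≤ (∑ j, b i j ^ 2) ^ ((1 : ℝ) / 3) * (∑ j, b i j) ^ ((1 : ℝ) / 3)
        * (∑ j, b i j) ^ ((1 : ℝ) / 3) := by
    intro i
    refine le_trans (le_of_eq ?_) (holder3 Finset.univ (fun j => b i j ^ 2) (b i) (b i) (1/3) (1/3)
      (1/3) (by norm_num) (by norm_num) (by norm_num) (by norm_num) (fun j => sq_nonneg _) (hb i) (hb i))
    refine Finset.sum_congr rfl fun j _ => ?_
    rw [← Real.rpow_natCast, ← Real.rpow_mul (hb i j), ← Real.rpow_add_of_nonneg (hb i j) (by norm_num)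
      (by norm_num), ← Real.rpow_add_of_nonneg (hb i j) (by norm_num) (by norm_num)]
    norm_num
  have m := minkowski (Finset.univ : Finset ι) (Finset.univ : Finset κ) b hb 2 (by norm_num)
  simp only [Real.rpow_two] at m
  have m2 := m.trans h2
  have nS : 0 ≤ ∑ i, (∑ j, b i j) ^ 2 := Finset.sum_nonneg fun i _ => sq_nonneg _
  have m3 : ∑ i, (∑ j, b i j) ^ 2 ≤ K ^ 2 := by
    rw [← Real.sqrt_eq_rpow] at m2
    exact (Real.sqrt_le_left hK).mp m2
  calc ∑ i, ∑ j, b i j ^ ((4 : ℝ) / 3)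
      ≤ ∑ i, ((∑ j, b i j ^ 2) ^ ((1 : ℝ) / 2)) ^ ((1 : ℝ) / 3)
          * ((∑ j, b i j ^ 2) ^ ((1 : ℝ) / 2)) ^ ((1 : ℝ) / 3)
          * ((∑ j, b i j) ^ 2) ^ ((1 : ℝ) / 3) := by
        refine Finset.sum_le_sum fun i _ => (s1 i).trans (le_of_eq ?_)
        rw [mul_assoc, ← Real.rpow_add_of_nonneg (n2 i) (by norm_num) (by norm_num),
          ← Real.rpow_mul (n1 i), ← Real.rpow_add_of_nonneg (n1 i) (by norm_num) (by norm_num),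
          ← Real.rpow_natCast (∑ j, b i j), ← Real.rpow_mul (n2 i)]
        norm_num
    _ ≤ _ := holder3 Finset.univ _ _ _ (1/3) (1/3) (1/3) (by norm_num) (by norm_num) (by norm_num)
        (by norm_num) (fun i => Real.rpow_nonneg (n1 i) _) (fun i => Real.rpow_nonneg (n1 i) _)
        (fun i => sq_nonneg _)
    _ ≤ K ^ ((1 : ℝ) / 3) * K ^ ((1 : ℝ) / 3) * (K ^ 2) ^ ((1 : ℝ) / 3) := by
        have : 0 ≤ ∑ i, (∑ j, b i j ^ 2) ^ ((1 : ℝ) / 2) :=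
          Finset.sum_nonneg fun i _ => Real.rpow_nonneg (n1 i) _
        gcongr
    _ = _ := by
        rw [← Real.rpow_natCast, ← Real.rpow_mul hK, ← Real.rpow_add_of_nonneg hK (by norm_num)
          (by norm_num), ← Real.rpow_add_of_nonneg hK (by norm_num) (by norm_num)]
        norm_num

lemma bil (b : ι → κ → ℝ) (K : ℝ)
    (H : ∀ (x : ι → ℤˣ) (y : κ → ℤˣ), ∑ i, ∑ j, b i j * sg (x i) * sg (y j) ≤ K) :
    ∑ i, ∑ j, |b i j| ^ ((4 : ℝ) / 3) ≤ (Real.sqrt 2 * K) ^ ((4 : ℝ) / 3) := by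
  apply bil_comb (fun i j => |b i j|) (fun i j => abs_nonneg _)
  · simp only [sq_abs]
    exact bil_one b K H
  · simp only [sq_abs]
    refine bil_one (fun j i => b i j) K fun y x => ?_
    refine le_trans (le_of_eq ?_) (H x y)
    rw [Finset.sum_comm]
    refine Finset.sum_congr rfl fun i _ => Finset.sum_congr rfl fun j _ => ?_
    ring

lemma tri_one (a : ι → κ → μ → ℝ) (K : ℝ) (hK : 0 ≤ K)
    (H : ∀ (x : ι → ℤˣ) (y : κ → ℤˣ) (z : μ → ℤˣ),
      ∑ i, ∑ j, ∑ k, a i j k * sg (x i) * sg (y j) * sg (z k) ≤ K) :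
    ∑ i, ∑ j, (∑ k, a i j k ^ 2) ^ ((2 : ℝ) / 3)
      ≤ ((2 : ℝ) ^ ((5 : ℝ) / 6) * K) ^ ((4 : ℝ) / 3) := by
  have h1 : ∀ z : μ → ℤˣ, ∑ i, ∑ j, |rs (a i j) Finset.univ z| ^ ((4 : ℝ) / 3)
      ≤ (Real.sqrt 2 * K) ^ ((4 : ℝ) / 3) := by
    intro z
    refine bil (fun i j => rs (a i j) Finset.univ z) K fun x y => ?_
    refine le_trans (le_of_eq ?_) (H x y z)
    refine Finset.sum_congr rfl fun i _ => Finset.sum_congr rfl fun j _ => ?_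
    rw [rs, Finset.sum_mul, Finset.sum_mul]
    refine Finset.sum_congr rfl fun k _ => ?_
    ring
  have h2 := Ex_mono h1
  rw [Ex_const, Ex_sum] at h2
  simp only [Ex_sum] at h2
  have h3 : (3 / 4) * ∑ i, ∑ j, (∑ k, a i j k ^ 2) ^ ((2 : ℝ) / 3)
      ≤ (Real.sqrt 2 * K) ^ ((4 : ℝ) / 3) := by
    refine le_trans ?_ h2
    rw [Finset.mul_sum]
    refine Finset.sum_le_sum fun i _ => ?_
    rw [Finset.mul_sum]
    exact Finset.sum_le_sum fun j _ => khin_four_thirds (a i j)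
  have h4 : (Real.sqrt 2 * K) ^ ((4 : ℝ) / 3)
      ≤ (3 / 4) * ((2 : ℝ) ^ ((5 : ℝ) / 6) * K) ^ ((4 : ℝ) / 3) := by
    rw [Real.mul_rpow (by positivity) hK, Real.mul_rpow (by positivity) hK, ← mul_assoc]
    refine mul_le_mul_of_nonneg_right ?_ (by positivity)
    rw [Real.sqrt_eq_rpow, ← Real.rpow_mul (by norm_num), ← Real.rpow_mul (by norm_num)]
    have e : (2 : ℝ) ^ ((5 : ℝ) / 6 * (4 / 3))
        = 2 ^ ((1 : ℝ) / 2 * (4 / 3)) * 2 ^ ((4 : ℝ) / 9) := by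
      rw [← Real.rpow_add (by norm_num)]; norm_num
    rw [e]
    have : (4 / 3 : ℝ) ≤ 2 ^ ((4 : ℝ) / 9) := by
      have h9 : ((4 / 3 : ℝ)) ^ 9 ≤ (2 ^ ((4 : ℝ) / 9)) ^ 9 := by
        rw [← Real.rpow_natCast (2 ^ ((4 : ℝ) / 9)), ← Real.rpow_mul (by norm_num)]
        norm_num
      exact le_of_pow_le_pow_left₀ (by norm_num) (by positivity) h9
    have hp : (0 : ℝ) < 2 ^ ((1 : ℝ) / 2 * (4 / 3)) := by positivity
    nlinarith
  linarith

lemma blei (a : ι → κ → μ → ℝ) (ha : ∀ i j k, 0 ≤ a i j k) (M : ℝ)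
    (h3 : ∑ i, ∑ j, (∑ k, a i j k ^ 2) ^ ((2 : ℝ) / 3) ≤ M)
    (h2 : ∑ i, ∑ k, (∑ j, a i j k ^ 2) ^ ((2 : ℝ) / 3) ≤ M)
    (h1 : ∑ j, ∑ k, (∑ i, a i j k ^ 2) ^ ((2 : ℝ) / 3) ≤ M) :
    ∑ i, ∑ j, ∑ k, a i j k ^ ((3 : ℝ) / 2) ≤ M ^ ((9 : ℝ) / 8) := by
  set P : ι → κ → ℝ := fun i j => ∑ k, a i j k ^ 2 with hP
  set V : ι → κ → ℝ := fun i j => ∑ k, a i j k ^ ((4 : ℝ) / 3) with hV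
  have nP : ∀ i j, 0 ≤ P i j := fun i j => Finset.sum_nonneg fun k _ => sq_nonneg _
  have nV : ∀ i j, 0 ≤ V i j := fun i j => Finset.sum_nonneg fun k _ => Real.rpow_nonneg (ha i j k) _
  have hM : 0 ≤ M := le_trans (Finset.sum_nonneg fun i _ => Finset.sum_nonneg fun j _ =>
    Real.rpow_nonneg (nP i j) _) h3
  have hpow : ∀ i j k, (a i j k ^ ((4 : ℝ) / 3)) ^ ((3 : ℝ) / 2) = a i j k ^ 2 := by
    intro i j k
    rw [← Real.rpow_mul (ha i j k), ← Real.rpow_two]; norm_num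
  -- step k
  have s1 : ∀ i j, ∑ k, a i j k ^ ((3 : ℝ) / 2)
      ≤ P i j ^ ((1 : ℝ) / 4) * V i j ^ ((3 : ℝ) / 8) * V i j ^ ((3 : ℝ) / 8) := by
    intro i j
    refine le_trans (le_of_eq ?_) (holder3 Finset.univ (fun k => a i j k ^ 2)
      (fun k => a i j k ^ ((4 : ℝ) / 3)) (fun k => a i j k ^ ((4 : ℝ) / 3)) (1/4) (3/8) (3/8)
      (by norm_num) (by norm_num) (by norm_num) (by norm_num) (fun k => sq_nonneg _)
      (fun k => Real.rpow_nonneg (ha i j k) _) (fun k => Real.rpow_nonneg (ha i j k) _))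
    refine Finset.sum_congr rfl fun k _ => ?_
    have h := ha i j k
    rw [← Real.rpow_two, ← Real.rpow_mul h, ← Real.rpow_mul h,
      ← Real.rpow_add_of_nonneg h (by norm_num) (by norm_num),
      ← Real.rpow_add_of_nonneg h (by norm_num) (by norm_num)]
    norm_num
  -- step j
  have s2 : ∀ i, ∑ j, ∑ k, a i j k ^ ((3 : ℝ) / 2)
      ≤ (∑ j, P i j ^ ((2 : ℝ) / 3)) ^ ((3 : ℝ) / 8)
        * (∑ j, V i j ^ ((3 : ℝ) / 2)) ^ ((1 : ℝ) / 4) * (∑ j, V i j) ^ ((3 : ℝ) / 8) := by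
    intro i
    refine le_trans (Finset.sum_le_sum fun j _ => (s1 i j).trans (le_of_eq ?_))
      (holder3 Finset.univ (fun j => P i j ^ ((2 : ℝ) / 3)) (fun j => V i j ^ ((3 : ℝ) / 2))
      (fun j => V i j) (3/8) (1/4) (3/8)
      (by norm_num) (by norm_num) (by norm_num) (by norm_num)
      (fun j => Real.rpow_nonneg (nP i j) _) (fun j => Real.rpow_nonneg (nV i j) _) (nV i))
    rw [← Real.rpow_mul (nP i j), ← Real.rpow_mul (nV i j)]
    norm_num
  -- Minkowski estimates
  have m2 : ∀ i, (∑ j, V i j ^ ((3 : ℝ) / 2)) ^ ((2 : ℝ) / 3)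
      ≤ ∑ k, (∑ j, a i j k ^ 2) ^ ((2 : ℝ) / 3) := by
    intro i
    have := minkowski (Finset.univ : Finset κ) (Finset.univ : Finset μ)
      (fun j k => a i j k ^ ((4 : ℝ) / 3)) (fun j k => Real.rpow_nonneg (ha i j k) _) (3/2)
      (by norm_num)
    simpa only [hpow, one_div_div] using this
  have m1 : (∑ i, (∑ j, V i j) ^ ((3 : ℝ) / 2)) ^ ((2 : ℝ) / 3) ≤ M := by
    refine le_trans ?_ h1
    have := minkowski (Finset.univ : Finset ι) (Finset.univ : Finset (κ × μ))
      (fun i p => a i p.1 p.2 ^ ((4 : ℝ) / 3)) (fun i p => Real.rpow_nonneg (ha i p.1 p.2) _) (3/2)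
      (by norm_num)
    simpa only [hpow, one_div_div, Fintype.sum_prod_type] using this
  have nV2 : ∀ i, 0 ≤ ∑ j, V i j ^ ((3 : ℝ) / 2) := fun i =>
    Finset.sum_nonneg fun j _ => Real.rpow_nonneg (nV i j) _
  have nV1 : ∀ i, 0 ≤ ∑ j, V i j := fun i => Finset.sum_nonneg fun j _ => nV i j
  have nV3 : 0 ≤ ∑ i, (∑ j, V i j) ^ ((3 : ℝ) / 2) :=
    Finset.sum_nonneg fun i _ => Real.rpow_nonneg (nV1 i) _
  have nP2 : ∀ i, 0 ≤ ∑ j, P i j ^ ((2 : ℝ) / 3) := fun i =>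
    Finset.sum_nonneg fun j _ => Real.rpow_nonneg (nP i j) _
  calc ∑ i, ∑ j, ∑ k, a i j k ^ ((3 : ℝ) / 2)
      ≤ ∑ i, (∑ j, P i j ^ ((2 : ℝ) / 3)) ^ ((3 : ℝ) / 8)
        * ((∑ j, V i j ^ ((3 : ℝ) / 2)) ^ ((2 : ℝ) / 3)) ^ ((3 : ℝ) / 8)
        * ((∑ j, V i j) ^ ((3 : ℝ) / 2)) ^ ((1 : ℝ) / 4) := by
        refine Finset.sum_le_sum fun i _ => (s2 i).trans (le_of_eq ?_)
        rw [← Real.rpow_mul (nV2 i), ← Real.rpow_mul (nV1 i)]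
        norm_num
    _ ≤ _ := holder3 Finset.univ _ _ _ (3/8) (3/8) (1/4) (by norm_num) (by norm_num) (by norm_num)
        (by norm_num) nP2 (fun i => Real.rpow_nonneg (nV2 i) _) (fun i => Real.rpow_nonneg (nV1 i) _)
    _ = (∑ i, ∑ j, P i j ^ ((2 : ℝ) / 3)) ^ ((3 : ℝ) / 8)
        * (∑ i, (∑ j, V i j ^ ((3 : ℝ) / 2)) ^ ((2 : ℝ) / 3)) ^ ((3 : ℝ) / 8)
        * ((∑ i, (∑ j, V i j) ^ ((3 : ℝ) / 2)) ^ ((2 : ℝ) / 3)) ^ ((3 : ℝ) / 8) := by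
        rw [← Real.rpow_mul nV3]; norm_num
    _ ≤ M ^ ((3 : ℝ) / 8) * M ^ ((3 : ℝ) / 8) * M ^ ((3 : ℝ) / 8) := by
        have q1 : 0 ≤ ∑ i, ∑ j, P i j ^ ((2 : ℝ) / 3) := Finset.sum_nonneg fun i _ => nP2 i
        have q2 : 0 ≤ ∑ i, (∑ j, V i j ^ ((3 : ℝ) / 2)) ^ ((2 : ℝ) / 3) :=
          Finset.sum_nonneg fun i _ => Real.rpow_nonneg (nV2 i) _
        have q3 : ∑ i, (∑ j, V i j ^ ((3 : ℝ) / 2)) ^ ((2 : ℝ) / 3) ≤ M :=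
          (Finset.sum_le_sum fun i _ => m2 i).trans h2
        gcongr
    _ = M ^ ((9 : ℝ) / 8) := by
        rw [← Real.rpow_add_of_nonneg hM (by norm_num) (by norm_num),
          ← Real.rpow_add_of_nonneg hM (by norm_num) (by norm_num)]
        norm_num

lemma tri (a : ι → κ → μ → ℝ) (K : ℝ) (hK : 0 ≤ K)
    (H : ∀ (x : ι → ℤˣ) (y : κ → ℤˣ) (z : μ → ℤˣ),
      ∑ i, ∑ j, ∑ k, a i j k * sg (x i) * sg (y j) * sg (z k) ≤ K) :
    (∑ i, ∑ j, ∑ k, |a i j k| ^ ((3 : ℝ) / 2)) ^ ((2 : ℝ) / 3) ≤ (2 : ℝ) ^ ((5 : ℝ) / 6) * K := by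
  set D := (2 : ℝ) ^ ((5 : ℝ) / 6) * K with hD
  have hDn : 0 ≤ D := by positivity
  have key := blei (fun i j k => |a i j k|) (fun i j k => abs_nonneg _) (D ^ ((4 : ℝ) / 3))
    (by
      simp only [sq_abs]
      exact tri_one a K hK H)
    (by
      simp only [sq_abs]
      refine tri_one (fun i k j => a i j k) K hK fun x z y => ?_
      refine le_trans (le_of_eq ?_) (H x y z)
      refine Finset.sum_congr rfl fun i _ => ?_
      rw [Finset.sum_comm]
      refine Finset.sum_congr rfl fun j _ => Finset.sum_congr rfl fun k _ => ?_
      ring)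
    (by
      simp only [sq_abs]
      refine tri_one (fun j k i => a i j k) K hK fun y z x => ?_
      refine le_trans (le_of_eq ?_) (H x y z)
      rw [Finset.sum_comm (s := (Finset.univ : Finset ι))]
      refine Finset.sum_congr rfl fun j _ => ?_
      rw [Finset.sum_comm (s := (Finset.univ : Finset ι))]
      refine Finset.sum_congr rfl fun k _ => Finset.sum_congr rfl fun i _ => ?_
      ring)
  rw [← Real.rpow_mul hDn] at key
  have n : 0 ≤ ∑ i, ∑ j, ∑ k, |a i j k| ^ ((3 : ℝ) / 2) := by positivity
  refine (Real.rpow_le_rpow n key (by norm_num)).trans (le_of_eq ?_)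
  rw [← Real.rpow_mul hDn]
  norm_num

/-- triples as functions on `Fin 3` -/
def tripleEquiv (α : Type*) : α × α × α ≃ (Fin 3 → α) where
  toFun p := ![p.1, p.2.1, p.2.2]
  invFun f := (f 0, f 1, f 2)
  left_inv p := rfl
  right_inv f := by
    funext i
    fin_cases i <;> rfl

end BH3

theorem stmt_13 (N : ℕ) (hN : 0 < N)
    (U : ContinuousMultilinearMap ℝ (fun _ : Fin 3 => Fin N → ℝ) ℝ) :
    (∑ i : Fin 3 → Fin N,
        |U (fun k => Pi.single (i k) 1)| ^ ((3 : ℝ) / 2)) ^ ((2 : ℝ) / 3)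
      ≤ 2 ^ ((5 : ℝ) / 6) * ‖U‖ := by
  have key := BH3.tri (fun i j k : Fin N => U (fun l => Pi.single ((![i, j, k] : Fin 3 → Fin N) l) 1))
    ‖U‖ (norm_nonneg _) (by
      intro x y z
      set s : Fin 3 → Fin N → ℤˣ := ![x, y, z] with hs
      have hexp : U (fun l => ∑ i, BH3.sg (s l i) • (Pi.single i 1 : Fin N → ℝ))
          = ∑ i, ∑ j, ∑ k, U (fun l => Pi.single ((![i, j, k] : Fin 3 → Fin N) l) 1)
            * BH3.sg (x i) * BH3.sg (y j) * BH3.sg (z k) := by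
        rw [U.map_sum, ← Equiv.sum_comp (BH3.tripleEquiv (Fin N)), Fintype.sum_prod_type]
        refine Finset.sum_congr rfl fun i _ => ?_
        rw [Fintype.sum_prod_type]
        refine Finset.sum_congr rfl fun j _ => Finset.sum_congr rfl fun k _ => ?_
        rw [U.map_smul_univ]
        simp only [Fin.prod_univ_three, smul_eq_mul]
        change BH3.sg (x i) * BH3.sg (y j) * BH3.sg (z k)
          * U (fun l => Pi.single ((![i, j, k] : Fin 3 → Fin N) l) 1) = _
        ring
      rw [← hexp]
      refine (le_abs_self _).trans ?_
      have h := U.le_opNorm (fun l => ∑ i, BH3.sg (s l i) • (Pi.single i 1 : Fin N → ℝ))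
      rw [Real.norm_eq_abs] at h
      refine h.trans ?_
      refine mul_le_of_le_one_right (norm_nonneg _) ?_
      refine Finset.prod_le_one (fun _ _ => norm_nonneg _) fun l _ => ?_
      rw [pi_norm_le_iff_of_nonneg zero_le_one]
      intro j
      simp [Finset.sum_apply, Pi.single_apply, BH3.sg_abs])
  refine le_trans (le_of_eq ?_) key
  rw [← Equiv.sum_comp (BH3.tripleEquiv (Fin N)), Fintype.sum_prod_type]
  simp only [Fintype.sum_prod_type]
  rfl
end

section
/- For every positive integer N and every 4-linear form U : (ℓ_∞^N)^4 → ℝ, (Σ_{i_1,...,i_4=1}^N |U(e_{i_1},...,e_{i_4})|^{8/5})^{5/8} ≤ 2 · ‖U‖. -/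
noncomputable def sg (b : Bool) : ℝ := if b then 1 else -1

lemma sg_sq (b : Bool) : sg b * sg b = 1 := by cases b <;> simp [sg]

lemma sg_abs (b : Bool) : |sg b| = 1 := by cases b <;> simp [sg]

lemma sg_not (b : Bool) : sg (!b) = - sg b := by cases b <;> simp [sg]

/-- Average over the discrete cube. -/
noncomputable def cubeE {n : ℕ} (f : (Fin n → Bool) → ℝ) : ℝ := (∑ x, f x) / 2 ^ n

lemma cubeE_add {n : ℕ} (f g : (Fin n → Bool) → ℝ) :
    cubeE (fun x => f x + g x) = cubeE f + cubeE g := by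
  simp [cubeE, Finset.sum_add_distrib, add_div]

lemma cubeE_smul {n : ℕ} (c : ℝ) (f : (Fin n → Bool) → ℝ) :
    cubeE (fun x => c * f x) = c * cubeE f := by
  simp [cubeE, ← Finset.mul_sum, mul_div_assoc]

lemma cubeE_mono {n : ℕ} {f g : (Fin n → Bool) → ℝ} (h : ∀ x, f x ≤ g x) :
    cubeE f ≤ cubeE g := by
  unfold cubeE
  have := Finset.sum_le_sum (fun x (_ : x ∈ Finset.univ) => h x)
  gcongr

lemma cubeE_sum {n : ℕ} {J : Type*} [Fintype J] (f : J → (Fin n → Bool) → ℝ) :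
    cubeE (fun x => ∑ j, f j x) = ∑ j, cubeE (f j) := by
  unfold cubeE
  rw [Finset.sum_comm, Finset.sum_div]

lemma cubeE_const {n : ℕ} (c : ℝ) : cubeE (fun _ : Fin n → Bool => c) = c := by
  simp [cubeE]

lemma cubeE_nonneg {n : ℕ} {f : (Fin n → Bool) → ℝ} (h : ∀ x, 0 ≤ f x) : 0 ≤ cubeE f := by
  have := cubeE_mono h
  rwa [cubeE_const] at this

lemma cubeE_equiv {n : ℕ} (e : (Fin n → Bool) ≃ (Fin n → Bool)) (f : (Fin n → Bool) → ℝ) :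
    cubeE (fun x => f (e x)) = cubeE f := by
  unfold cubeE
  rw [e.sum_comp]

lemma cubeE_succ {n : ℕ} (f : (Fin (n + 1) → Bool) → ℝ) :
    cubeE f = cubeE (fun x : Fin n → Bool =>
      (f (Fin.cons true x) + f (Fin.cons false x)) / 2) := by
  unfold cubeE
  rw [← (Fin.consEquiv (fun _ : Fin (n + 1) => Bool)).sum_comp, Fintype.sum_prod_type]
  simp only [Fintype.sum_bool, Fin.consEquiv, Equiv.coe_fn_mk]
  rw [← Finset.sum_add_distrib, ← Finset.sum_div, pow_succ]
  field_simp

/-- flip one coordinate -/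
def flipc {n : ℕ} (i : Fin n) (x : Fin n → Bool) : Fin n → Bool := Function.update x i (!x i)

lemma flipc_flipc {n : ℕ} (i : Fin n) (x : Fin n → Bool) : flipc i (flipc i x) = x := by
  simp [flipc]

lemma flipc_zero {n : ℕ} (b : Bool) (x : Fin n → Bool) :
    flipc 0 (Fin.cons b x : Fin (n + 1) → Bool) = Fin.cons (!b) x := by
  simp [flipc]

lemma flipc_succ {n : ℕ} (i : Fin n) (b : Bool) (x : Fin n → Bool) :
    flipc i.succ (Fin.cons b x : Fin (n + 1) → Bool) = Fin.cons b (flipc i x) := by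
  simp [flipc, Fin.cons_update]

noncomputable def energy {n : ℕ} (f : (Fin n → Bool) → ℝ) : ℝ :=
  ∑ i, cubeE (fun x => ((f x - f (flipc i x)) / 2) ^ 2)

noncomputable def lev {n : ℕ} (f : (Fin n → Bool) → ℝ) : ℝ :=
  ∑ i, (cubeE (fun x => f x * sg (x i))) ^ 2

noncomputable def gpart {n : ℕ} (f : (Fin (n + 1) → Bool) → ℝ) (x : Fin n → Bool) : ℝ :=
  (f (Fin.cons true x) + f (Fin.cons false x)) / 2

noncomputable def hpart {n : ℕ} (f : (Fin (n + 1) → Bool) → ℝ) (x : Fin n → Bool) : ℝ :=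
  (f (Fin.cons true x) - f (Fin.cons false x)) / 2

lemma mean_succ {n : ℕ} (f : (Fin (n + 1) → Bool) → ℝ) : cubeE f = cubeE (gpart f) :=
  cubeE_succ f

lemma sq_succ {n : ℕ} (f : (Fin (n + 1) → Bool) → ℝ) :
    cubeE (fun x => f x ^ 2) = cubeE (fun x => gpart f x ^ 2) + cubeE (fun x => hpart f x ^ 2) := by
  rw [cubeE_succ, ← cubeE_add]
  congr 1; funext x; simp only [gpart, hpart]; ring

lemma energy_succ {n : ℕ} (f : (Fin (n + 1) → Bool) → ℝ) :
    energy f = energy (gpart f) + energy (hpart f) + cubeE (fun x => hpart f x ^ 2) := by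
  unfold energy
  rw [Fin.sum_univ_succ, ← Finset.sum_add_distrib, add_comm]
  congr 1
  · refine Finset.sum_congr rfl fun i _ => ?_
    rw [cubeE_succ, ← cubeE_add]
    congr 1; funext x; simp only [gpart, hpart, flipc_succ]; ring
  · rw [cubeE_succ]
    congr 1; funext x; simp only [hpart, flipc_zero, Bool.not_true, Bool.not_false]; ring

lemma lev_succ {n : ℕ} (f : (Fin (n + 1) → Bool) → ℝ) :
    lev f = lev (gpart f) + (cubeE (hpart f)) ^ 2 := by
  unfold lev
  rw [Fin.sum_univ_succ, add_comm]
  congr 1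
  · refine Finset.sum_congr rfl fun i _ => ?_
    rw [cubeE_succ]
    congr 2; funext x; simp only [gpart, Fin.cons_succ]; ring
  · rw [cubeE_succ]
    congr 2; funext x; simp only [hpart, Fin.cons_zero, sg]; simp; ring

lemma poincare {n : ℕ} (f : (Fin n → Bool) → ℝ) :
    cubeE (fun x => f x ^ 2) - (cubeE f) ^ 2 ≤ energy f := by
  induction n with
  | zero => simp [cubeE, energy]
  | succ n ih =>
    rw [sq_succ, mean_succ, energy_succ]
    have h1 := ih (gpart f)
    have h2 : 0 ≤ energy (hpart f) :=
      Finset.sum_nonneg fun i _ => cubeE_nonneg fun x => sq_nonneg _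
    linarith

lemma poincare2 {n : ℕ} (f : (Fin n → Bool) → ℝ) :
    2 * cubeE (fun x => f x ^ 2) - 2 * (cubeE f) ^ 2 ≤ energy f + lev f := by
  induction n with
  | zero => simp [cubeE, energy, lev]
  | succ n ih =>
    rw [sq_succ, mean_succ, energy_succ, lev_succ]
    have h1 := ih (gpart f)
    have h2 := poincare (hpart f)
    linarith

/-- Rademacher sum -/
noncomputable def rad {n : ℕ} (c : Fin n → ℝ) (x : Fin n → Bool) : ℝ := ∑ i, c i * sg (x i)

lemma rad_flip {n : ℕ} (c : Fin n → ℝ) (x : Fin n → Bool) (i : Fin n) :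
    rad c (flipc i x) = rad c x - 2 * (c i * sg (x i)) := by
  unfold rad
  rw [← Finset.add_sum_erase _ _ (Finset.mem_univ i),
    ← Finset.add_sum_erase _ (fun j => c j * sg (x j)) (Finset.mem_univ i)]
  have : ∑ j ∈ Finset.univ.erase i, c j * sg (flipc i x j) =
      ∑ j ∈ Finset.univ.erase i, c j * sg (x j) := by
    refine Finset.sum_congr rfl fun j hj => ?_
    simp [flipc, Finset.ne_of_mem_erase hj]
  rw [this]
  simp [flipc, sg_not]; ring

lemma rad_succ {n : ℕ} (c : Fin (n + 1) → ℝ) (b : Bool) (x : Fin n → Bool) :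
    rad c (Fin.cons b x) = c 0 * sg b + rad (fun i => c i.succ) x := by
  simp [rad, Fin.sum_univ_succ]

lemma rad_sq {n : ℕ} (c : Fin n → ℝ) : cubeE (fun x => rad c x ^ 2) = ∑ i, c i ^ 2 := by
  induction n with
  | zero => simp [cubeE, rad]
  | succ n ih =>
    rw [cubeE_succ, Fin.sum_univ_succ, ← ih, ← cubeE_const (n := n) (c 0 ^ 2), ← cubeE_add]
    congr 1; funext x; simp only [rad_succ, sg]; simp; ring

lemma khin_one_sq {n : ℕ} (c : Fin n → ℝ) :
    ∑ i, c i ^ 2 ≤ 2 * (cubeE (fun x => |rad c x|)) ^ 2 := by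
  have h := poincare2 (fun x => |rad c x|)
  have hsq : cubeE (fun x => |rad c x| ^ 2) = ∑ i, c i ^ 2 := by
    simp only [sq_abs]; exact rad_sq c
  have hlev : lev (fun x => |rad c x|) = 0 := by
    unfold lev
    refine Finset.sum_eq_zero fun i _ => ?_
    let e : (Fin n → Bool) ≃ (Fin n → Bool) :=
      ⟨fun x i => !x i, fun x i => !x i, fun x => by simp, fun x => by simp⟩
    have h1 := cubeE_equiv e (fun x => |rad c x| * sg (x i))
    have h2 : (fun x => |rad c (e x)| * sg (e x i)) = fun x => (-1) * (|rad c x| * sg (x i)) := by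
      funext x
      have : rad c (e x) = - rad c x := by
        simp [rad, e, sg_not]
      rw [this, abs_neg]
      simp [e, sg_not]
    rw [h2, cubeE_smul] at h1
    have : cubeE (fun x => |rad c x| * sg (x i)) = 0 := by linarith
    rw [this]; norm_num
  have hen : energy (fun x => |rad c x|) ≤ cubeE (fun x => |rad c x| ^ 2) := by
    have h1 : ∀ i : Fin n, cubeE (fun x => ((|rad c x| - |rad c (flipc i x)|) / 2) ^ 2)
        = cubeE (fun x => |rad c x| * (|rad c x| - |rad c (flipc i x)|) / 2) := by
      intro i
      let e : (Fin n → Bool) ≃ (Fin n → Bool) :=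
        ⟨flipc i, flipc i, flipc_flipc i, flipc_flipc i⟩
      have h3 := cubeE_equiv e (fun x => |rad c x| ^ 2)
      have h4 : cubeE (fun x => ((|rad c x| - |rad c (flipc i x)|) / 2) ^ 2)
        = cubeE (fun x => |rad c x| * (|rad c x| - |rad c (flipc i x)|) / 2)
          + (1/4) * cubeE (fun x => |rad c (e x)| ^ 2) + (-1/4) * cubeE (fun x => |rad c x| ^ 2) := by
        rw [← cubeE_smul, ← cubeE_smul, ← cubeE_add, ← cubeE_add]
        congr 1; funext x
        simp only [e, Equiv.coe_fn_mk]; ring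
      rw [h4, h3]; ring
    unfold energy
    simp only [h1]
    rw [← cubeE_sum]
    refine cubeE_mono fun x => ?_
    have h5 : ∑ i, rad c (flipc i x) = (n - 2) * rad c x := by
      simp only [rad_flip, Finset.sum_sub_distrib, ← Finset.mul_sum]
      simp [rad]; ring
    have h6 : (n - 2) * |rad c x| ≤ ∑ i, |rad c (flipc i x)| := by
      calc (n - 2) * |rad c x| ≤ |((n:ℝ) - 2)| * |rad c x| := by gcongr; exact le_abs_self _
        _ = |∑ i, rad c (flipc i x)| := by rw [h5, abs_mul]
        _ ≤ _ := Finset.abs_sum_le_sum_abs _ _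
    have h7 : ∑ i, |rad c x| * (|rad c x| - |rad c (flipc i x)|) / 2 =
        |rad c x| * (n * |rad c x| - ∑ i, |rad c (flipc i x)|) / 2 := by
      rw [← Finset.sum_div, ← Finset.mul_sum, Finset.sum_sub_distrib]; simp
    rw [h7]
    nlinarith [abs_nonneg (rad c x)]
  rw [hlev] at h
  rw [hsq] at h hen
  linarith

/-- Khinchine inequality with exponent `q` and constant `K`. -/
def Khin (q K : ℝ) : Prop := ∀ (n : ℕ) (c : Fin n → ℝ),
  (∑ i, c i ^ 2) ^ (q / 2) ≤ K ^ q * cubeE (fun x => |rad c x| ^ q)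

lemma khin_one : Khin 1 (√2) := by
  intro n c
  have h := khin_one_sq c
  have h0 : 0 ≤ cubeE (fun x => |rad c x|) := cubeE_nonneg fun x => abs_nonneg _
  simp only [Real.rpow_one, ← Real.sqrt_eq_rpow]
  rw [Real.sqrt_le_left (by positivity), mul_pow, Real.sq_sqrt (by norm_num)]
  exact h

lemma cube_prod {n : ℕ} (F : Fin n → Bool → ℂ) :
    (∑ x : Fin n → Bool, ∏ k, F k (x k)) / 2 ^ n = ∏ k, ((F k true + F k false) / 2) := by
  rw [Finset.prod_div_distrib, Finset.prod_const, Finset.card_univ, Fintype.card_fin]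
  congr 1
  have := Finset.prod_univ_sum (fun _ : Fin n => (Finset.univ : Finset Bool)) F
  simp only [Fintype.sum_bool, Fintype.piFinset_univ] at this
  exact this.symm

lemma cubeE_ofReal {n : ℕ} (f : (Fin n → Bool) → ℝ) :
    ((cubeE f : ℝ) : ℂ) = (∑ x, (f x : ℂ)) / 2 ^ n := by
  simp [cubeE]

noncomputable def rzP {n : ℕ} (c : Fin n → ℝ) (x : Fin n → Bool) : ℂ :=
  ∏ k, (1 + Complex.I * c k * sg (x k))

noncomputable def rzM {n : ℕ} (c : Fin n → ℝ) (x : Fin n → Bool) : ℂ :=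
  ∏ k, (1 - Complex.I * c k * sg (x k))

/-- Imaginary part of a Riesz product. -/
noncomputable def rz {n : ℕ} (c : Fin n → ℝ) (x : Fin n → Bool) : ℝ := (rzP c x).im

lemma rz_eq {n : ℕ} (c : Fin n → ℝ) (x : Fin n → Bool) :
    (rz c x : ℂ) = (rzP c x - rzM c x) / (2 * Complex.I) := by
  have h : rzM c x = (starRingEnd ℂ) (rzP c x) := by
    simp [rzM, rzP, map_prod, sub_eq_add_neg]
  rw [h, Complex.sub_conj, rz]
  field_simp
  push_cast; ring

lemma rz_mom {n : ℕ} (c : Fin n → ℝ) (a b : ℕ) :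
    (∑ x, rzP c x ^ a * rzM c x ^ b) / 2 ^ n =
      ∏ k, (((1 + Complex.I * c k) ^ a * (1 - Complex.I * c k) ^ b
        + (1 - Complex.I * c k) ^ a * (1 + Complex.I * c k) ^ b) / 2) := by
  have := cube_prod (fun k (s : Bool) => (1 + Complex.I * c k * sg s) ^ a
    * (1 - Complex.I * c k * sg s) ^ b)
  simp only [Finset.prod_mul_distrib, Finset.prod_pow] at this
  simp only [rzP, rzM]
  rw [this]
  refine Finset.prod_congr rfl fun k _ => ?_
  simp [sg, sub_eq_add_neg]

lemma rz_four {n : ℕ} (c : Fin n → ℝ) :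
    cubeE (fun x => rz c x ^ 4) = 3 / 8 * ∏ k, (1 + c k ^ 2) ^ 2 - 1 / 2 * ∏ k, (1 - (c k ^ 2) ^ 2)
      + 1 / 8 * ∏ k, (1 - 6 * c k ^ 2 + (c k ^ 2) ^ 2) := by
  have hI := Complex.I_sq
  have hI4 : Complex.I ^ 4 = 1 := Complex.I_pow_four
  have h40 := rz_mom c 4 0
  have h31 := rz_mom c 3 1
  have h22 := rz_mom c 2 2
  have h13 := rz_mom c 1 3
  have h04 := rz_mom c 0 4
  have e40 : ∀ k, ((1 + Complex.I * c k) ^ 4 * (1 - Complex.I * c k) ^ 0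
        + (1 - Complex.I * c k) ^ 4 * (1 + Complex.I * c k) ^ 0) / 2
        = 1 - 6 * (c k : ℂ) ^ 2 + ((c k : ℂ) ^ 2) ^ 2 := fun k => by
    linear_combination (6 * (c k : ℂ) ^ 2) * hI + (c k : ℂ) ^ 4 * hI4
  have e31 : ∀ k, ((1 + Complex.I * c k) ^ 3 * (1 - Complex.I * c k) ^ 1
        + (1 - Complex.I * c k) ^ 3 * (1 + Complex.I * c k) ^ 1) / 2
        = 1 - ((c k : ℂ) ^ 2) ^ 2 := fun k => by
    linear_combination  - (c k : ℂ) ^ 4 * hI4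
  have e22 : ∀ k, ((1 + Complex.I * c k) ^ 2 * (1 - Complex.I * c k) ^ 2
        + (1 - Complex.I * c k) ^ 2 * (1 + Complex.I * c k) ^ 2) / 2
        = (1 + (c k : ℂ) ^ 2) ^ 2 := fun k => by
    linear_combination (-2 * (c k : ℂ) ^ 2) * hI + (c k : ℂ) ^ 4 * hI4
  have e13 : ∀ k, ((1 + Complex.I * c k) ^ 1 * (1 - Complex.I * c k) ^ 3
        + (1 - Complex.I * c k) ^ 1 * (1 + Complex.I * c k) ^ 3) / 2
        = 1 - ((c k : ℂ) ^ 2) ^ 2 := fun k => by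
    linear_combination  - (c k : ℂ) ^ 4 * hI4
  have e04 : ∀ k, ((1 + Complex.I * c k) ^ 0 * (1 - Complex.I * c k) ^ 4
        + (1 - Complex.I * c k) ^ 0 * (1 + Complex.I * c k) ^ 4) / 2
        = 1 - 6 * (c k : ℂ) ^ 2 + ((c k : ℂ) ^ 2) ^ 2 := fun k => by
    linear_combination (6 * (c k : ℂ) ^ 2) * hI + (c k : ℂ) ^ 4 * hI4
  simp only [e40] at h40
  simp only [e31] at h31
  simp only [e22] at h22
  simp only [e13] at h13
  simp only [e04] at h04
  apply Complex.ofReal_injective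
  rw [cubeE_ofReal]
  push_cast
  have hx : ∀ x, ((rz c x : ℂ)) ^ 4 = 1 / 16 * (rzP c x ^ 4 * rzM c x ^ 0)
      + (-1 / 4) * (rzP c x ^ 3 * rzM c x ^ 1) + 3 / 8 * (rzP c x ^ 2 * rzM c x ^ 2)
      + (-1 / 4) * (rzP c x ^ 1 * rzM c x ^ 3) + 1 / 16 * (rzP c x ^ 0 * rzM c x ^ 4) := fun x => by
    rw [rz_eq, div_pow, mul_pow, hI4]; ring
  simp only [hx, Finset.sum_add_distrib, ← Finset.mul_sum, add_div, mul_div_assoc]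
  rw [h40, h31, h22, h13, h04]
  ring

lemma rz_two {n : ℕ} (c : Fin n → ℝ) :
    cubeE (fun x => rz c x ^ 2) = (∏ k, (1 + c k ^ 2) - ∏ k, (1 - c k ^ 2)) / 2 := by
  have hI := Complex.I_sq
  have h20 := rz_mom c 2 0
  have h11 := rz_mom c 1 1
  have h02 := rz_mom c 0 2
  have e20 : ∀ k, ((1 + Complex.I * c k) ^ 2 * (1 - Complex.I * c k) ^ 0
        + (1 - Complex.I * c k) ^ 2 * (1 + Complex.I * c k) ^ 0) / 2
        = 1 - (c k : ℂ) ^ 2 := fun k => by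
    linear_combination ((c k : ℂ) ^ 2) * hI
  have e11 : ∀ k, ((1 + Complex.I * c k) ^ 1 * (1 - Complex.I * c k) ^ 1
        + (1 - Complex.I * c k) ^ 1 * (1 + Complex.I * c k) ^ 1) / 2
        = 1 + (c k : ℂ) ^ 2 := fun k => by
    linear_combination (-(c k : ℂ) ^ 2) * hI
  have e02 : ∀ k, ((1 + Complex.I * c k) ^ 0 * (1 - Complex.I * c k) ^ 2
        + (1 - Complex.I * c k) ^ 0 * (1 + Complex.I * c k) ^ 2) / 2
        = 1 - (c k : ℂ) ^ 2 := fun k => by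
    linear_combination ((c k : ℂ) ^ 2) * hI
  simp only [e20] at h20
  simp only [e11] at h11
  simp only [e02] at h02
  apply Complex.ofReal_injective
  rw [cubeE_ofReal]
  push_cast
  have hx : ∀ x, ((rz c x : ℂ)) ^ 2 = (-1 / 4) * (rzP c x ^ 2 * rzM c x ^ 0)
      + (1 / 2) * (rzP c x ^ 1 * rzM c x ^ 1) + (-1 / 4) * (rzP c x ^ 0 * rzM c x ^ 2) := fun x => by
    rw [rz_eq, div_pow, mul_pow, hI]; ring
  simp only [hx, Finset.sum_add_distrib, ← Finset.mul_sum, add_div, mul_div_assoc]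
  rw [h20, h11, h02]
  ring

lemma rz_sg {n : ℕ} (c : Fin n → ℝ) (k : Fin n) :
    cubeE (fun x => sg (x k) * rz c x) = c k := by
  have h1 : (∑ x, (sg (x k) : ℂ) * rzP c x) / 2 ^ n = Complex.I * c k := by
    have := cube_prod (fun j (s : Bool) => (if j = k then (sg s : ℂ) else 1)
      * (1 + Complex.I * c j * sg s))
    simp only [Finset.prod_mul_distrib, Finset.prod_ite_eq', Finset.mem_univ, if_true] at this
    simp only [rzP]
    rw [this]
    have h2 : ∀ j, ((if j = k then (sg true : ℂ) else 1) * (1 + Complex.I * c j * sg true)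
      + (if j = k then (sg false : ℂ) else 1) * (1 + Complex.I * c j * sg false)) / 2
      = if j = k then Complex.I * c j else 1 := fun j => by
      by_cases h : j = k <;> simp [h, sg] <;> ring
    simp only [h2, Finset.prod_ite_eq', Finset.mem_univ, if_true]
  have h3 := congrArg Complex.im h1
  have h4 : (∑ x, (sg (x k) : ℂ) * rzP c x) / 2 ^ n
      = ((1 / 2 ^ n : ℝ) : ℂ) * (∑ x, (sg (x k) : ℂ) * rzP c x) := by
    push_cast; ring
  rw [h4, Complex.im_ofReal_mul, Complex.im_sum] at h3
  simp only [Complex.im_ofReal_mul] at h3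
  simp at h3
  rw [← h3]
  unfold cubeE rz
  field_simp

lemma rz_rad {n : ℕ} (c : Fin n → ℝ) :
    cubeE (fun x => rad c x * rz c x) = ∑ k, c k ^ 2 := by
  have : (fun x => rad c x * rz c x) = fun x => ∑ k, c k * (sg (x k) * rz c x) := by
    funext x
    rw [rad, Finset.sum_mul]
    exact Finset.sum_congr rfl fun k _ => by ring
  rw [this, cubeE_sum]
  refine Finset.sum_congr rfl fun k _ => ?_
  rw [cubeE_smul, rz_sg]; ring

lemma prod_diff_bound {J : Type*} (s : Finset J) (u : J → ℝ) (hu : ∀ j, 0 ≤ u j) :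
    ∏ j ∈ s, (1 + u j) - ∏ j ∈ s, (1 - u j) ≤ 2 * Real.sinh (∑ j ∈ s, u j) ∧
    ∏ j ∈ s, (1 + u j) + ∏ j ∈ s, (1 - u j) ≤ 2 * Real.cosh (∑ j ∈ s, u j) := by
  classical
  induction s using Finset.induction_on with
  | empty => simp; norm_num
  | insert i s hi ih =>
    obtain ⟨h1, h2⟩ := ih
    rw [Finset.prod_insert hi, Finset.prod_insert hi, Finset.sum_insert hi, Real.sinh_add,
      Real.cosh_add]
    have hS : 0 ≤ Real.sinh (∑ j ∈ s, u j) :=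
      Real.sinh_nonneg_iff.2 (Finset.sum_nonneg fun j _ => hu j)
    have hC := Real.one_le_cosh (∑ j ∈ s, u j)
    have hc := Real.one_le_cosh (u i)
    have hs : u i ≤ Real.sinh (u i) := Real.self_le_sinh_iff.2 (hu i)
    have hui := hu i
    constructor
    · nlinarith [mul_le_mul_of_nonneg_left h2 hui, mul_nonneg hS (sub_nonneg.2 hc),
        mul_nonneg (by linarith : 0 ≤ Real.cosh (∑ j ∈ s, u j)) (sub_nonneg.2 hs)]
    · nlinarith [mul_le_mul_of_nonneg_left h1 hui, mul_nonneg hS (sub_nonneg.2 hs),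
        mul_nonneg (by linarith : 0 ≤ Real.cosh (∑ j ∈ s, u j)) (sub_nonneg.2 hc)]

lemma sinh_third : Real.sinh (1 / 3) ≤ 35 / 100 := by
  have h1 : Real.exp (1 / 3) ^ 3 = Real.exp 1 := by rw [← Real.exp_nat_mul]; norm_num
  have h2 := Real.exp_one_lt_d9
  have h3 : Real.exp (1 / 3) ≤ 14 / 10 := by
    by_contra hc
    push Not at hc
    have : (14 / 10 : ℝ) ^ 3 < Real.exp (1 / 3) ^ 3 := by gcongr
    rw [h1] at this
    norm_num at this; linarith
  have h4 : 7 / 10 ≤ Real.exp (-(1 / 3)) := by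
    rw [Real.exp_neg, le_inv_comm₀ (by norm_num) (Real.exp_pos _)]
    linarith
  rw [Real.sinh_eq]; linarith

lemma exp_two_thirds : 1926 / 1000 ≤ Real.exp (2 / 3) ∧ Real.exp (2 / 3) ≤ 195 / 100 := by
  have h1 : Real.exp (2 / 3) ^ 3 = Real.exp 1 ^ 2 := by
    rw [← Real.exp_nat_mul, ← Real.exp_nat_mul]; norm_num
  have h2 := Real.exp_one_lt_d9
  have h2' := Real.exp_one_gt_d9
  have h5 : Real.exp 1 ^ 2 ≤ 7.39 := by nlinarith
  have h6 : 7.38 ≤ Real.exp 1 ^ 2 := by nlinarith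
  have hp := Real.exp_pos (2 / 3 : ℝ)
  constructor
  · by_contra hc
    push Not at hc
    have : Real.exp (2 / 3) ^ 3 < (1926 / 1000 : ℝ) ^ 3 := by gcongr
    rw [h1] at this
    norm_num at this h6; linarith
  · by_contra hc
    push Not at hc
    have : (195 / 100 : ℝ) ^ 3 < Real.exp (2 / 3) ^ 3 := by gcongr
    rw [h1] at this
    norm_num at this h5; linarith

lemma exp_third_bound : Real.exp (-(29 / 15)) ≤ 15 / 100 := by
  have h1 : Real.exp (29 / 15) ^ 15 = Real.exp 1 ^ 29 := by
    rw [← Real.exp_nat_mul, ← Real.exp_nat_mul]; norm_num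
  have h2' := Real.exp_one_gt_d9
  have h3 : (20 / 3 : ℝ) ≤ Real.exp (29 / 15) := by
    by_contra hc
    push Not at hc
    have hp := Real.exp_pos (29 / 15 : ℝ)
    have h4 : Real.exp (29 / 15) ^ 15 < (20 / 3 : ℝ) ^ 15 := by gcongr
    have h5 : (2.718 : ℝ) ^ 29 ≤ Real.exp 1 ^ 29 := by
      apply pow_le_pow_left₀ (by norm_num)
      linarith
    rw [h1] at h4
    have := h5.trans_lt h4
    norm_num at this
  rw [Real.exp_neg, inv_le_comm₀ (Real.exp_pos _) (by norm_num)]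
  linarith

lemma third_prod {n : ℕ} (u : Fin n → ℝ) (hu : ∀ k, 0 ≤ u k) (hs : ∑ k, u k = 1 / 3) :
    ∏ k, (1 - 6 * u k + u k ^ 2) ≤ 15 / 100 := by
  have hle : ∀ k, u k ≤ 1 / 3 := fun k => hs ▸
    Finset.single_le_sum (fun j _ => hu j) (Finset.mem_univ k)
  by_cases hneg : ∃ j, 1 - 6 * u j + u j ^ 2 < 0
  · obtain ⟨j, hj⟩ := hneg
    have huj : 17 / 100 < u j := by
      by_contra hc
      push Not at hc
      nlinarith [hu j]
    rw [← Finset.mul_prod_erase _ _ (Finset.mem_univ j)]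
    have : 0 ≤ ∏ k ∈ Finset.univ.erase j, (1 - 6 * u k + u k ^ 2) := by
      refine Finset.prod_nonneg fun k hk => ?_
      have h1 : u k + u j ≤ 1 / 3 := by
        rw [← hs, ← Finset.sum_pair (Finset.ne_of_mem_erase hk)]
        exact Finset.sum_le_sum_of_subset_of_nonneg (Finset.subset_univ _) fun i _ _ => hu i
      nlinarith [hu k]
    nlinarith
  · push Not at hneg
    calc ∏ k, (1 - 6 * u k + u k ^ 2) ≤ ∏ k, Real.exp (-(29 / 5) * u k) := by
          refine Finset.prod_le_prod (fun k _ => hneg k) fun k _ => ?_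
          have h1 : u k ≤ 1 / 5 := by
            by_contra hc
            push Not at hc
            nlinarith [hneg k, hle k]
          have := Real.add_one_le_exp (-(29 / 5) * u k)
          nlinarith [hu k]
      _ = Real.exp (-(29 / 15)) := by
          rw [← Real.exp_sum, ← Finset.mul_sum, hs]; norm_num
      _ ≤ _ := exp_third_bound

lemma one_sub_sum_le_prod {J : Type*} (s : Finset J) (v : J → ℝ) (hv : ∀ j, 0 ≤ v j ∧ v j ≤ 1) :
    1 - ∑ j ∈ s, v j ≤ ∏ j ∈ s, (1 - v j) := by
  classical
  induction s using Finset.induction_on with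
  | empty => simp
  | insert i s hi ih =>
    rw [Finset.prod_insert hi, Finset.sum_insert hi]
    obtain ⟨h0, h1⟩ := hv i
    have h2 : 0 ≤ ∑ j ∈ s, v j := Finset.sum_nonneg fun j _ => (hv j).1
    nlinarith [mul_le_mul_of_nonneg_left ih (sub_nonneg.2 h1), mul_nonneg h0 h2]

lemma four_bound {n : ℕ} (u : Fin n → ℝ) (hu : ∀ k, 0 ≤ u k) (hs : ∑ k, u k = 1 / 3) :
    3 / 8 * ∏ k, (1 + u k) ^ 2 - 1 / 2 * ∏ k, (1 - (u k) ^ 2)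
      + 1 / 8 * ∏ k, (1 - 6 * u k + (u k) ^ 2) ≤ 1 / 4 := by
  have hle : ∀ k, u k ≤ 1 / 3 := fun k => hs ▸
    Finset.single_le_sum (fun j _ => hu j) (Finset.mem_univ k)
  have h3 := third_prod u hu hs
  set s := ∑ k, u k ^ 2 with hsdef
  have hs0 : 0 ≤ s := Finset.sum_nonneg fun k _ => sq_nonneg _
  have hs1 : s ≤ 1 / 9 := by
    calc s ≤ ∑ k, (1 / 3) * u k := Finset.sum_le_sum fun k _ => by nlinarith [hu k, hle k]
      _ = 1 / 9 := by rw [← Finset.mul_sum, hs]; norm_num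
  have h2 : 1 - s ≤ ∏ k, (1 - (u k) ^ 2) := by
    refine one_sub_sum_le_prod Finset.univ (fun k => u k ^ 2) fun k => ⟨sq_nonneg _, ?_⟩
    show u k ^ 2 ≤ 1
    nlinarith [hu k, hle k]
  have h1 : ∏ k, (1 + u k) ^ 2 ≤ Real.exp (2 / 3) / (1 + 3 / 4 * s) := by
    calc ∏ k, (1 + u k) ^ 2 ≤ ∏ k, Real.exp (2 * u k - 3 / 4 * u k ^ 2) := by
          refine Finset.prod_le_prod (fun k _ => sq_nonneg _) fun k _ => ?_
          have hx : 0 ≤ u k - 3 / 8 * u k ^ 2 := by nlinarith [hu k, hle k]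
          have h4 := Real.quadratic_le_exp_of_nonneg hx
          have h5 : 1 + u k ≤ Real.exp (u k - 3 / 8 * u k ^ 2) := by
            refine le_trans ?_ h4
            have : 0 ≤ u k ^ 2 * ((1 - 3 / 8 * u k) ^ 2 / 2 - 3 / 8) :=
              mul_nonneg (sq_nonneg _) (by nlinarith [hu k, hle k])
            nlinarith
          calc (1 + u k) ^ 2 ≤ Real.exp (u k - 3 / 8 * u k ^ 2) ^ 2 := by
                have := hu k
                gcongr
            _ = _ := by rw [← Real.exp_nat_mul]; congr 1; push_cast; ring
      _ = Real.exp (2 / 3) / Real.exp (3 / 4 * s) := by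
          rw [← Real.exp_sum, Finset.sum_sub_distrib, ← Finset.mul_sum, ← Finset.mul_sum, hs,
            ← Real.exp_sub, ← hsdef]
          norm_num
      _ ≤ _ := by
          have := Real.add_one_le_exp (3 / 4 * s)
          gcongr
          linarith
  obtain ⟨hE1, hE2⟩ := exp_two_thirds
  have h6 : Real.exp (2 / 3) / (1 + 3 / 4 * s) ≤ Real.exp (2 / 3) - 4 / 3 * s := by
    rw [div_le_iff₀ (by positivity)]
    nlinarith [mul_nonneg hs0 (sub_nonneg.2 hs1)]
  linarith

lemma rz_four_le {n : ℕ} (c : Fin n → ℝ) (hc : ∑ k, c k ^ 2 = 1 / 3) :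
    cubeE (fun x => rz c x ^ 4) ≤ 1 / 4 := by
  rw [rz_four]
  exact four_bound (fun k => c k ^ 2) (fun k => sq_nonneg _) hc

lemma rz_two_le {n : ℕ} (c : Fin n → ℝ) (hc : ∑ k, c k ^ 2 = 1 / 3) :
    cubeE (fun x => rz c x ^ 2) ≤ 35 / 100 := by
  rw [rz_two]
  have h := (prod_diff_bound Finset.univ (fun k => c k ^ 2) (fun k => sq_nonneg _)).1
  rw [hc] at h
  linarith [sinh_third]

lemma cubeE_holder {n : ℕ} (f g : (Fin n → Bool) → ℝ) {p q : ℝ} (hpq : p.HolderConjugate q) :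
    cubeE (fun x => f x * g x) ≤
      cubeE (fun x => |f x| ^ p) ^ (1 / p) * cubeE (fun x => |g x| ^ q) ^ (1 / q) := by
  have h := Real.inner_le_Lp_mul_Lq Finset.univ f g hpq
  unfold cubeE
  rw [Real.div_rpow (Finset.sum_nonneg fun x _ => by positivity) (by positivity),
    Real.div_rpow (Finset.sum_nonneg fun x _ => by positivity) (by positivity),
    div_mul_div_comm, ← Real.rpow_add (by positivity)]
  have : 1 / p + 1 / q = 1 := by simpa using hpq.inv_add_inv_eq_one
  rw [this, Real.rpow_one]
  gcongr

lemma khin_of_norm {q K : ℝ} (hK : 0 ≤ K) (hq : 0 < q)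
    (h : ∀ (n : ℕ) (c : Fin n → ℝ), ∑ k, c k ^ 2 = 1 / 3 →
      (1 / 3 : ℝ) ^ (q / 2) ≤ K ^ q * cubeE (fun x => |rad c x| ^ q)) : Khin q K := by
  intro n c
  set s := ∑ i, c i ^ 2 with hs
  have hs0 : 0 ≤ s := Finset.sum_nonneg fun k _ => sq_nonneg _
  have hE0 : 0 ≤ cubeE (fun x => |rad c x| ^ q) := cubeE_nonneg fun x => by positivity
  rcases hs0.eq_or_lt with h0 | h0
  · rw [← h0, Real.zero_rpow (by positivity)]; positivity
  set l := √(1 / (3 * s)) with hl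
  have hl0 : 0 < l := Real.sqrt_pos.2 (by positivity)
  have hl2 : l ^ 2 = 1 / (3 * s) := Real.sq_sqrt (by positivity)
  have h1 : ∑ k, (l * c k) ^ 2 = 1 / 3 := by
    simp only [mul_pow, ← Finset.mul_sum]
    rw [← hs, hl2]; field_simp
  have h2 := h n (fun k => l * c k) h1
  have h3 : ∀ x, |rad (fun k => l * c k) x| ^ q = l ^ q * |rad c x| ^ q := fun x => by
    have : rad (fun k => l * c k) x = l * rad c x := by
      simp [rad, Finset.mul_sum, mul_assoc]
    rw [this, abs_mul, abs_of_pos hl0, Real.mul_rpow hl0.le (abs_nonneg _)]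
  simp only [h3] at h2
  rw [cubeE_smul] at h2
  have h4 : (1 / 3 : ℝ) ^ (q / 2) = l ^ q * s ^ (q / 2) := by
    have : (1 / 3 : ℝ) = l ^ 2 * s := by rw [hl2]; field_simp
    rw [this, Real.mul_rpow (by positivity) hs0, ← Real.rpow_natCast l 2, ← Real.rpow_mul hl0.le]
    congr 2
    push_cast; ring
  rw [h4] at h2
  have hlq : 0 < l ^ q := by positivity
  nlinarith

lemma khin_43 : Khin (4 / 3) (√(3 / 2)) := by
  apply khin_of_norm (by positivity) (by norm_num)
  intro n c hc
  have h := cubeE_holder (rad c) (rz c) (p := 4 / 3) (q := 4)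
    (by rw [Real.holderConjugate_iff]; norm_num)
  rw [rz_rad, hc] at h
  have hY : cubeE (fun x => |rz c x| ^ (4 : ℝ)) ≤ 1 / 4 := by
    refine le_trans (le_of_eq ?_) (rz_four_le c hc)
    congr 1; funext x
    rw [show (4 : ℝ) = ((4 : ℕ) : ℝ) by norm_num, Real.rpow_natCast, Even.pow_abs (by decide)]
  have hX0 : 0 ≤ cubeE (fun x => |rad c x| ^ (4 / 3 : ℝ)) := cubeE_nonneg fun x => by positivity
  have hY0 : 0 ≤ cubeE (fun x => |rz c x| ^ (4 : ℝ)) := cubeE_nonneg fun x => by positivity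
  set X := cubeE (fun x => |rad c x| ^ (4 / 3 : ℝ))
  set Y := cubeE (fun x => |rz c x| ^ (4 : ℝ))
  have h1 : (1 / 3 : ℝ) ^ 4 ≤ X ^ 3 * Y := by
    calc (1 / 3 : ℝ) ^ 4 ≤ (X ^ (1 / (4 / 3) : ℝ) * Y ^ (1 / 4 : ℝ)) ^ 4 := by gcongr
      _ = X ^ 3 * Y := by
        rw [mul_pow, ← Real.rpow_mul_natCast hX0, ← Real.rpow_mul_natCast hY0]
        norm_num
  have h2 : 4 / 81 ≤ X ^ 3 := by nlinarith [pow_nonneg hX0 3]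
  have h3 : ((1 / 3 : ℝ) ^ ((4 / 3 : ℝ) / 2)) ^ 3 = 1 / 9 := by
    rw [← Real.rpow_mul_natCast (by norm_num)]; norm_num
  have h4 : ((√(3 / 2)) ^ (4 / 3 : ℝ)) ^ 3 = 9 / 4 := by
    rw [← Real.rpow_mul_natCast (by positivity),
      show (4 / 3 : ℝ) * ((3 : ℕ) : ℝ) = ((4 : ℕ) : ℝ) by norm_num, Real.rpow_natCast,
      show 4 = 2 * 2 by norm_num, pow_mul, Real.sq_sqrt (by norm_num)]
    norm_num
  refine le_of_pow_le_pow_left₀ (n := 3) (by norm_num) (by positivity) ?_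
  rw [mul_pow, h3, h4]; linarith

lemma khin_32 : Khin (3 / 2) (√(4 / 3)) := by
  apply khin_of_norm (by positivity) (by norm_num)
  intro n c hc
  have h := cubeE_holder (rad c) (rz c) (p := 3 / 2) (q := 3)
    (by rw [Real.holderConjugate_iff]; norm_num)
  rw [rz_rad, hc] at h
  have hW0 : 0 ≤ cubeE (fun x => |rz c x| ^ (3 : ℝ)) := cubeE_nonneg fun x => by positivity
  have hW : cubeE (fun x => |rz c x| ^ (3 : ℝ)) ≤ 8 / 27 := by
    have h2 := cubeE_holder (fun x => |rz c x|) (fun x => rz c x ^ 2) (p := 2) (q := 2)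
      (by rw [Real.holderConjugate_iff]; norm_num)
    have e0 : (fun x => |rz c x| * rz c x ^ 2) = fun x => |rz c x| ^ (3 : ℝ) := by
      funext x
      rw [show (3 : ℝ) = ((3 : ℕ) : ℝ) by norm_num, Real.rpow_natCast, ← sq_abs]; ring
    have e1 : (fun x => |(|rz c x|)| ^ (2 : ℝ)) = fun x => rz c x ^ 2 := by
      funext x
      rw [show (2 : ℝ) = ((2 : ℕ) : ℝ) by norm_num, Real.rpow_natCast, abs_abs, sq_abs]
    have e2 : (fun x => |rz c x ^ 2| ^ (2 : ℝ)) = fun x => rz c x ^ 4 := by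
      funext x
      rw [show (2 : ℝ) = ((2 : ℕ) : ℝ) by norm_num, Real.rpow_natCast, sq_abs]; ring
    rw [e0, e1, e2, ← Real.sqrt_eq_rpow, ← Real.sqrt_eq_rpow] at h2
    refine h2.trans ?_
    rw [← Real.sqrt_mul (cubeE_nonneg fun x => sq_nonneg _)]
    refine Real.sqrt_le_iff.2 ⟨by norm_num, ?_⟩
    have h5 : 0 ≤ cubeE (fun x => rz c x ^ 2) := cubeE_nonneg fun x => sq_nonneg _
    calc _ ≤ (35 / 100 : ℝ) * (1 / 4) := by
          have := rz_two_le c hc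
          have := rz_four_le c hc
          exact mul_le_mul (by assumption) this
            (cubeE_nonneg fun x => Even.pow_nonneg (by decide) _) (by norm_num)
      _ ≤ _ := by norm_num
  have hX0 : 0 ≤ cubeE (fun x => |rad c x| ^ (3 / 2 : ℝ)) := cubeE_nonneg fun x => by positivity
  set X := cubeE (fun x => |rad c x| ^ (3 / 2 : ℝ))
  set Y := cubeE (fun x => |rz c x| ^ (3 : ℝ))
  have h1 : (1 / 3 : ℝ) ^ 3 ≤ X ^ 2 * Y := by
    calc (1 / 3 : ℝ) ^ 3 ≤ (X ^ (1 / (3 / 2) : ℝ) * Y ^ (1 / 3 : ℝ)) ^ 3 := by gcongr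
      _ = X ^ 2 * Y := by
        rw [mul_pow, ← Real.rpow_mul_natCast hX0, ← Real.rpow_mul_natCast hW0]
        norm_num
  have h2 : 1 / 8 ≤ X ^ 2 := by nlinarith [pow_nonneg hX0 2]
  have h3 : ((1 / 3 : ℝ) ^ ((3 / 2 : ℝ) / 2)) ^ 4 = 1 / 27 := by
    rw [← Real.rpow_mul_natCast (by norm_num)]; norm_num
  have h4 : ((√(4 / 3)) ^ (3 / 2 : ℝ)) ^ 4 = 64 / 27 := by
    rw [← Real.rpow_mul_natCast (by positivity),
      show (3 / 2 : ℝ) * ((4 : ℕ) : ℝ) = ((6 : ℕ) : ℝ) by norm_num, Real.rpow_natCast,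
      show 6 = 2 * 3 by norm_num, pow_mul, Real.sq_sqrt (by norm_num)]
    norm_num
  refine le_of_pow_le_pow_left₀ (n := 4) (by norm_num) (by positivity) ?_
  rw [mul_pow, h3, h4]
  nlinarith

lemma chain_density {m : ℕ} {I : Type} [Fintype I] [DecidableEq I] (P : (Fin m → I) → ℝ)
    (hP : ∀ i, 0 ≤ P i) :
    ∃ p : Fin m → (Fin m → I) → ℝ, (∀ k i, 0 ≤ p k i) ∧
      (∀ k i, ∑ t, p k (Function.update i k t) ≤ 1) ∧
      (∀ i, 0 < P i → ∏ k, p k i = P i / ∑ j, P j) := by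
  classical
  let T : ℕ → (Fin m → I) → ℝ := fun k i =>
    ∑ j, if (∀ l : Fin m, l.val < k → j l = i l) then P j else 0
  have hT0 : ∀ k i, 0 ≤ T k i := fun k i => Finset.sum_nonneg fun j _ => by
    split_ifs
    · exact hP j
    · exact le_rfl
  have hTP : ∀ k i, P i ≤ T k i := fun k i => by
    have := Finset.single_le_sum (f := fun j => if (∀ l : Fin m, l.val < k → j l = i l) then P j else 0)
      (fun j _ => by
        show (0:ℝ) ≤ if _ then _ else _
        split_ifs
        · exact hP j
        · exact le_rfl) (Finset.mem_univ i)
    simpa using this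
  have hTm : ∀ i, T m i = P i := fun i => by
    have : ∀ j : Fin m → I, (∀ l : Fin m, l.val < m → j l = i l) ↔ j = i := fun j =>
      ⟨fun h => funext fun l => h l l.isLt, fun h l _ => by rw [h]⟩
    simp only [T, this]; simp
  have hTz : ∀ i, T 0 i = ∑ j, P j := fun i => by simp [T]
  refine ⟨fun k i => T (k + 1) i / T k i, fun k i => div_nonneg (hT0 _ _) (hT0 _ _), ?_, ?_⟩
  · intro k i
    have h1 : ∀ t, T k (Function.update i k t) = T k i := fun t => by
      refine Finset.sum_congr rfl fun j _ => ?_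
      congr 1
      refine propext (forall_congr' fun l => ?_)
      refine imp_congr_right fun hl => ?_
      rw [Function.update_of_ne (by intro h; rw [h] at hl; exact lt_irrefl _ hl)]
    have h2 : ∑ t, T (k + 1) (Function.update i k t) = T k i := by
      show ∑ t, ∑ j, _ = ∑ j, _
      rw [Finset.sum_comm]
      refine Finset.sum_congr rfl fun j _ => ?_
      have : ∀ t, (∀ l : Fin m, l.val < k.val + 1 → j l = Function.update i k t l) ↔
          (t = j k ∧ ∀ l : Fin m, l.val < k.val → j l = i l) := fun t => by
        constructor
        · intro h
          refine ⟨by have := h k (Nat.lt_succ_self _); simpa using this.symm, fun l hl => ?_⟩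
          have := h l (by omega)
          rwa [Function.update_of_ne (by intro h; rw [h] at hl; exact lt_irrefl _ hl)] at this
        · rintro ⟨rfl, h⟩ l hl
          by_cases hlk : l = k
          · subst hlk; simp
          · rw [Function.update_of_ne hlk]
            exact h l (by have : l.val ≠ k.val := fun h => hlk (Fin.ext h)
                          omega)
      simp only [this, ite_and, Finset.sum_ite_eq', Finset.mem_univ, if_true]
    simp only [h1]
    rw [← Finset.sum_div, h2]
    exact div_self_le_one _
  · intro i hi
    have hpos : ∀ k, 0 < T k i := fun k => lt_of_lt_of_le hi (hTP k i)
    rw [Fin.prod_univ_eq_prod_range (fun k => T (k + 1) i / T k i) m, ← hTm i, ← hTz i]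
    have : ∀ r : ℕ, ∏ k ∈ Finset.range r, T (k + 1) i / T k i = T r i / T 0 i := by
      intro r
      induction r with
      | zero => simp [(hpos 0).ne']
      | succ r ih =>
        rw [Finset.prod_range_succ, ih]
        have := (hpos r).ne'
        have := (hpos 0).ne'
        field_simp
    exact this m

lemma sum_insertNth {n : ℕ} {I : Type} [Fintype I] (k : Fin (n + 1)) (f : (Fin (n + 1) → I) → ℝ) :
    ∑ i, f i = ∑ j : Fin n → I, ∑ t : I, f (k.insertNth t j) := by
  rw [← (Fin.insertNthEquiv (fun _ : Fin (n + 1) => I) k).sum_comp, Fintype.sum_prod_type,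
    Finset.sum_comm]
  rfl

lemma blei {n : ℕ} (hn : 1 ≤ n) {I : Type} [Fintype I] [DecidableEq I]
    (a : (Fin (n + 1) → I) → ℝ) (L : ℝ)
    (h : ∀ k : Fin (n + 1), ∑ j : Fin n → I,
      (∑ t : I, (a (k.insertNth t j)) ^ 2) ^ ((2 * n / (n + 1) : ℝ) / 2) ≤ L) :
    (∑ i, |a i| ^ (2 * (n + 1) / (n + 2) : ℝ)) ≤
      L ^ ((2 * (n + 1) / (n + 2) : ℝ) / (2 * n / (n + 1) : ℝ)) := by
  have hn0 : (1 : ℝ) ≤ n := by exact_mod_cast hn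
  set q : ℝ := 2 * n / (n + 1) with hq
  set ρ : ℝ := 2 * (n + 1) / (n + 2) with hρ
  set m : ℝ := n + 1 with hm
  have hm0 : 0 < m := by positivity
  have hq0 : 0 < q := by positivity
  have hρ0 : 0 < ρ := by positivity
  set Z := ∑ i, |a i| ^ ρ with hZ
  have hZ0 : 0 ≤ Z := Finset.sum_nonneg fun i _ => by positivity
  have hL0 : 0 ≤ L := le_trans (Finset.sum_nonneg fun j _ => by positivity) (h 0)
  rcases hZ0.eq_or_lt with hz | hzpos
  · rw [← hz]; positivity
  obtain ⟨p, hp0, hp1, hp2⟩ := chain_density (fun i => |a i| ^ ρ) (fun i => by positivity)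
  -- each weighted sum is bounded
  have key : ∀ k, ∑ i, |a i| ^ q * p k i ^ (1 / m) ≤ L := by
    intro k
    rw [sum_insertNth k]
    refine le_trans (Finset.sum_le_sum fun j _ => ?_) (h k)
    have hconj : (m / n).HolderConjugate m := by
      rw [Real.holderConjugate_iff]
      constructor
      · rw [lt_div_iff₀ (by linarith)]; linarith
      · rw [hm]; field_simp
    have hold := Real.inner_le_Lp_mul_Lq Finset.univ
      (fun t : I => |a (k.insertNth t j)| ^ q) (fun t : I => p k (k.insertNth t j) ^ (1 / m)) hconj
    refine hold.trans ?_
    have e1 : ∀ t : I, |(|a (k.insertNth t j)| ^ q)| ^ (m / n) = a (k.insertNth t j) ^ 2 := by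
      intro t
      rw [abs_of_nonneg (by positivity), ← Real.rpow_mul (abs_nonneg _)]
      have : q * (m / n) = (2 : ℕ) := by rw [hq]; push_cast; field_simp
      rw [this, Real.rpow_natCast, sq_abs]
    have e2 : ∀ t : I, |p k (k.insertNth t j) ^ (1 / m)| ^ m = p k (k.insertNth t j) := by
      intro t
      rw [abs_of_nonneg (Real.rpow_nonneg (hp0 _ _) _), ← Real.rpow_mul (hp0 _ _),
        one_div_mul_cancel hm0.ne', Real.rpow_one]
    simp only [e1, e2]
    have e3 : ∑ t, p k (k.insertNth t j) ≤ 1 := by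
      rcases isEmpty_or_nonempty I with hI | ⟨⟨t0⟩⟩
      · simp
      · have := hp1 k (k.insertNth t0 j)
        simpa using this
    have e4 : (∑ t, p k (k.insertNth t j)) ^ (1 / m) ≤ 1 :=
      Real.rpow_le_one (Finset.sum_nonneg fun t _ => hp0 _ _) e3 (by positivity)
    have e5 : 1 / (m / n) = q / 2 := by rw [hq]; field_simp
    rw [e5]
    exact mul_le_of_le_one_right (by positivity) e4
  have main : Z ^ (1 - 1 / m ^ 2) ≤ L := by
    have h1 : ∀ i, |a i| ^ ρ * Z ^ (-(1 / m ^ 2)) ≤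
        ∑ k : Fin (n + 1), (1 / m) * (|a i| ^ q * p k i ^ (1 / m)) := by
      intro i
      have hnn : ∀ k, 0 ≤ |a i| ^ q * p k i ^ (1 / m) := fun k =>
        mul_nonneg (by positivity) (Real.rpow_nonneg (hp0 _ _) _)
      rcases (abs_nonneg (a i)).eq_or_lt with h0 | h0
      · rw [← h0, Real.zero_rpow hρ0.ne', zero_mul]
        rw [← h0] at hnn
        exact Finset.sum_nonneg fun k _ => mul_nonneg (by positivity) (hnn k)
      have ag := Real.geom_mean_le_arith_mean_weighted Finset.univ
        (fun _ : Fin (n + 1) => 1 / m) (fun k => |a i| ^ q * p k i ^ (1 / m))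
        (fun _ _ => by positivity) (by simp [hm]; field_simp) (fun k _ => hnn k)
      refine le_trans (le_of_eq ?_) ag
      have hPi : 0 < |a i| ^ ρ := by positivity
      have h2 := hp2 i hPi
      rw [Real.finsetProd_rpow _ _ (fun k _ => hnn k), Finset.prod_mul_distrib,
        Real.finsetProd_rpow _ _ (fun k _ => hp0 k i), h2, Finset.prod_const, Finset.card_univ,
        Fintype.card_fin, ← Real.rpow_natCast (|a i| ^ q) (n + 1), Nat.cast_add, Nat.cast_one, ← hm,
        ← hZ, Real.mul_rpow (by positivity) (by positivity), ← Real.rpow_mul (by positivity),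
        ← Real.rpow_mul (by positivity), ← Real.rpow_mul (by positivity),
        Real.div_rpow (by positivity) (by positivity), ← Real.rpow_mul (by positivity),
        div_eq_mul_inv (|a i| ^ _) (Z ^ _), ← Real.rpow_neg hZ0, ← mul_assoc, ← Real.rpow_add h0]
      congr 2
      · rw [hq, hρ, hm]; field_simp; ring
      · field_simp
    have h2 := Finset.sum_le_sum fun i (_ : i ∈ Finset.univ) => h1 i
    rw [← Finset.sum_mul, Finset.sum_comm, ← hZ] at h2
    rw [sub_eq_add_neg, Real.rpow_add hzpos, Real.rpow_one]
    refine h2.trans ?_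
    have h3 : ∀ k : Fin (n + 1), ∑ i, 1 / m * (|a i| ^ q * p k i ^ (1 / m)) ≤ 1 / m * L := by
      intro k
      rw [← Finset.mul_sum]
      have := key k
      gcongr
    refine (Finset.sum_le_sum fun k _ => h3 k).trans (le_of_eq ?_)
    simp [hm]; field_simp
  have h4 : ρ / q * (1 - 1 / m ^ 2) = 1 := by
    rw [hq, hρ, hm]; field_simp; ring
  calc Z = (Z ^ (1 - 1 / m ^ 2)) ^ (ρ / q) := by
        rw [← Real.rpow_mul hZ0, mul_comm, h4, Real.rpow_one]
    _ ≤ L ^ (ρ / q) := by gcongr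

/-- Bohnenblust-Hille inequality for coefficient arrays. -/
def BH (n : ℕ) (ρ C : ℝ) : Prop := ∀ (N : ℕ) (a : (Fin n → Fin N) → ℝ) (M : ℝ), 0 ≤ M →
  (∀ x : Fin n → Fin N → Bool, |∑ i, a i * ∏ k, sg (x k (i k))| ≤ M) →
  ∑ i, |a i| ^ ρ ≤ (C * M) ^ ρ

lemma bh_one : BH 1 1 1 := by
  intro N a M hM h
  have h1 := h (fun _ t => decide (0 ≤ a (fun _ => t)))
  simp only [Real.rpow_one, one_mul]
  refine le_trans (le_of_eq ?_) ((le_abs_self _).trans h1)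
  refine Finset.sum_congr rfl fun i _ => ?_
  have hi : (fun _ : Fin 1 => i 0) = i := by
    funext l; rw [Subsingleton.elim l 0]
  simp only [Finset.univ_unique, Fin.default_eq_zero, Finset.prod_singleton, hi]
  by_cases h0 : 0 ≤ a i
  · simp [sg, h0, abs_of_nonneg h0]
  · simp [sg, h0, abs_of_neg (not_le.1 h0)]

lemma bh_step_s14 {n : ℕ} (hn : 1 ≤ n) {K C : ℝ} (hK0 : 0 ≤ K) (hC0 : 0 ≤ C)
    (hK : Khin (2 * n / (n + 1)) K) (hC : BH n (2 * n / (n + 1)) C) :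
    BH (n + 1) (2 * (n + 1) / (n + 2)) (K * C) := by
  intro N a M hM h
  have hn0 : (1 : ℝ) ≤ n := by exact_mod_cast hn
  have hq0 : (0 : ℝ) < 2 * n / (n + 1) := by positivity
  have hb := blei hn a ((K * C * M) ^ (2 * n / (n + 1) : ℝ)) ?_
  · rwa [← Real.rpow_mul (by positivity), mul_div_cancel₀ _ hq0.ne'] at hb
  intro k
  set q : ℝ := 2 * n / (n + 1)
  calc ∑ j : Fin n → Fin N, (∑ t, (a (k.insertNth t j)) ^ 2) ^ (q / 2)
      ≤ ∑ j : Fin n → Fin N, K ^ q * cubeE (fun e => |rad (fun t => a (k.insertNth t j)) e| ^ q) :=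
        Finset.sum_le_sum fun j _ => hK N _
    _ = K ^ q * cubeE (fun e => ∑ j : Fin n → Fin N,
          |rad (fun t => a (k.insertNth t j)) e| ^ q) := by
        rw [← Finset.mul_sum, cubeE_sum]
    _ ≤ K ^ q * cubeE (fun _ : Fin N → Bool => (C * M) ^ q) := by
        have : cubeE (fun e => ∑ j : Fin n → Fin N,
          |rad (fun t => a (k.insertNth t j)) e| ^ q) ≤
            cubeE (fun _ : Fin N → Bool => (C * M) ^ q) := by
          refine cubeE_mono fun e => hC N _ M hM fun x => ?_
          have h1 := h (k.insertNth e x)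
          rw [sum_insertNth k] at h1
          refine le_trans (le_of_eq ?_) h1
          congr 1
          refine Finset.sum_congr rfl fun j _ => ?_
          rw [rad, Finset.sum_mul]
          refine Finset.sum_congr rfl fun t _ => ?_
          rw [Fin.prod_univ_succAbove _ k]
          simp only [Fin.insertNth_apply_same, Fin.insertNth_apply_succAbove]
          ring
        gcongr
    _ = (K * C * M) ^ q := by
        rw [cubeE_const, mul_assoc, Real.mul_rpow hK0 (by positivity)]

lemma bh_four : BH 4 (8 / 5) 2 := by
  have h2 := bh_step_s14 (n := 1) le_rfl (K := √2) (C := 1) (by positivity) zero_le_one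
    (by convert khin_one using 1; norm_num) (by convert bh_one using 1; norm_num)
  have h3 := bh_step_s14 (n := 2) (by norm_num) (K := √(3 / 2)) (C := √2 * 1) (by positivity) (by positivity)
    (by convert khin_43 using 1; norm_num) (by convert h2 using 1; norm_num)
  have h4 := bh_step_s14 (n := 3) (by norm_num) (K := √(4 / 3)) (C := √(3 / 2) * (√2 * 1)) (by positivity) (by positivity)
    (by convert khin_32 using 1; norm_num) (by convert h3 using 1; norm_num)
  convert h4 using 1
  · norm_num
  · rw [mul_one, ← Real.sqrt_mul (by norm_num), ← Real.sqrt_mul (by norm_num)]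
    rw [show (4 / 3 * (3 / 2 * 2) : ℝ) = 2 ^ 2 by norm_num, Real.sqrt_sq (by norm_num)]

theorem stmt_14 (N : ℕ) (hN : 0 < N)
    (U : ContinuousMultilinearMap ℝ (fun _ : Fin 4 => Fin N → ℝ) ℝ) :
    (∑ i : Fin 4 → Fin N,
        |U (fun k => Pi.single (i k) 1)| ^ ((8 : ℝ) / 5)) ^ ((5 : ℝ) / 8)
      ≤ 2 * ‖U‖ := by
  have h := bh_four N (fun i => U (fun k => Pi.single (i k) 1)) ‖U‖ (norm_nonneg _) ?_
  · calc _ ≤ ((2 * ‖U‖) ^ ((8 : ℝ) / 5)) ^ ((5 : ℝ) / 8) := by gcongr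
      _ = 2 * ‖U‖ := by
        rw [← Real.rpow_mul (by positivity)]; norm_num
  intro x
  have h1 : ∑ i : Fin 4 → Fin N, U (fun k => Pi.single (i k) 1) * ∏ k, sg (x k (i k))
      = U (fun k t => sg (x k t)) := by
    have h2 : (fun k t => sg (x k t)) =
        fun k : Fin 4 => ∑ t : Fin N, sg (x k t) • (Pi.single t (1 : ℝ) : Fin N → ℝ) := by
      funext k t
      simp [Finset.sum_apply, Pi.single_apply]
    rw [h2, U.map_sum]
    refine Finset.sum_congr rfl fun i _ => ?_
    rw [U.map_smul_univ (fun k => sg (x k (i k))) (fun k => Pi.single (i k) 1), smul_eq_mul, mul_comm]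
  rw [h1, ← Real.norm_eq_abs]
  refine (U.le_opNorm _).trans ?_
  refine mul_le_of_le_one_right (norm_nonneg _) ?_
  refine Finset.prod_le_one (fun k _ => norm_nonneg _) fun k _ => ?_
  rw [pi_norm_le_iff_of_nonneg zero_le_one]
  intro t
  rw [Real.norm_eq_abs, sg_abs]
end
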